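/- arXiv:1604.07356 — 4 statements merged into one kernel-verified Lean document; each statement's English description precedes it below -/
import Mathlib

section
/- Let X be a dataset of N points in ℝⁿ and let Λ_f(v¹,v²) be the angular-distance functional computed by the random-projection scheme with f the Heaviside step function, β(x,y) = x·y and Ψ the mean, i.e. Λ_f(v¹,v²) = E[(1/m)Σ_{i=1}^m f(⟨rⁱ,v¹⟩)·f(⟨rⁱ,v²⟩)] for independent standard Gaussian r¹,…,r^m (a fixed function of the angle between v¹ and v²). Run the structured algorithm with the structured matrix taken from one of the classes: circulant, skew-circulant, Toeplitz, or Hankel Gaussian matrices (each produced by the corresponding normalized P-model). Then for n large enough and any 0 < τ < 0.5, the probability that there exists a pair of linearly independent points of X for which the value computed by the algorithm differs from Λ_f by more than m^{−τ} + 1/log(m) is at most O(N²·e^{−m^{1−2τ}}). -/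
open MeasureTheory ProbabilityTheory Real Finset

noncomputable section

/-- Dot product on `ℝⁿ`. -/
def dotv {n : ℕ} (x y : Fin n → ℝ) : ℝ := ∑ i, x i * y i

/-- Standard Gaussian measure on `ℝ^d`. -/
def gaussPi (d : ℕ) : Measure (Fin d → ℝ) := Measure.pi fun _ => gaussianReal 0 1

/-- The sign `±1` attached to a Boolean coin flip. -/
def signOf (b : Bool) : ℝ := if b then 1 else -1

/-- Uniform measure on `n` independent `±1` coin flips. -/
def signM (n : ℕ) : Measure (Fin n → Bool) := (PMF.uniformOfFintype (Fin n → Bool)).toMeasure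

/-- The Heaviside step function. -/
def heaviside (x : ℝ) : ℝ := if 0 ≤ x then 1 else 0

/-- Circulant Gaussian matrix: rows are successive cyclic shifts of the budget vector
(only the first `n` budget coordinates are used). -/
def circMat (n m : ℕ) (hn : 0 < n) (g : Fin (n + m) → ℝ) : Matrix (Fin m) (Fin n) ℝ :=
  fun i j => g ⟨((j : ℕ) + (n - (i : ℕ) % n)) % n,
    Nat.lt_of_lt_of_le (Nat.mod_lt _ hn) (Nat.le_add_right n m)⟩

/-- Skew-circulant Gaussian matrix. -/
def skewCircMat (n m : ℕ) (hn : 0 < n) (g : Fin (n + m) → ℝ) : Matrix (Fin m) (Fin n) ℝ :=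
  fun i j =>
    if h : (i : ℕ) % n ≤ (j : ℕ) then
      g ⟨(j : ℕ) - (i : ℕ) % n, by have hj := j.isLt; omega⟩
    else
      - g ⟨n + (j : ℕ) - (i : ℕ) % n, by have hi := Nat.mod_lt (i : ℕ) hn; omega⟩

/-- Toeplitz Gaussian matrix: constant along diagonals, with the distinct entries given by
distinct coordinates of the budget vector. -/
def toepMat (n m : ℕ) (g : Fin (n + m) → ℝ) : Matrix (Fin m) (Fin n) ℝ :=
  fun i j => g ⟨m - 1 - (i : ℕ) + (j : ℕ), by have hi := i.isLt; have hj := j.isLt; omega⟩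

/-- Hankel Gaussian matrix: constant along anti-diagonals, with the distinct entries given
by distinct coordinates of the budget vector. -/
def hankMat (n m : ℕ) (g : Fin (n + m) → ℝ) : Matrix (Fin m) (Fin n) ℝ :=
  fun i j => g ⟨(i : ℕ) + (j : ℕ), by have hi := i.isLt; have hj := j.isLt; omega⟩

/-- The nonlinear embedding computed by the algorithm: `v ↦ f(A D₁ H D₀ v)` coordinatewise. -/
def algEmb (n m : ℕ) (f : ℝ → ℝ) (A : Matrix (Fin m) (Fin n) ℝ)
    (H : Matrix (Fin n) (Fin n) ℝ) (d0 d1 : Fin n → Bool) (v : Fin n → ℝ) : Fin m → ℝ :=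
  fun i => f (∑ c, A i c * (signOf (d1 c) * (∑ e, H c e * (signOf (d0 e) * v e))))

open Matrix WithLp
open scoped RealInnerProductSpace MatrixOrder

instance isProbabilityMeasure_gaussPi (d : ℕ) : IsProbabilityMeasure (gaussPi d) := by
  unfold gaussPi; infer_instance

lemma integral_cexp_dotv_gaussPi {d : ℕ} (a : Fin d → ℝ) :
    ∫ g, Complex.exp ((dotv g a : ℝ) * Complex.I) ∂(gaussPi d) =
      Complex.exp (-(dotv a a : ℝ) / 2) := by
  unfold dotv gaussPi
  simp_rw [Complex.ofReal_sum, Finset.sum_mul, Complex.exp_sum]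
  rw [integral_fintype_prod_eq_prod
    (f := fun i (x : ℝ) ↦ Complex.exp (((x * a i : ℝ) : ℂ) * Complex.I))]
  have h (i : Fin d) : ∫ x : ℝ, Complex.exp (((x * a i : ℝ) : ℂ) * Complex.I) ∂(gaussianReal 0 1) =
      Complex.exp (-((a i * a i : ℝ) : ℂ) / 2) := by
    have := charFun_gaussianReal (μ := 0) (v := 1) (a i)
    rw [charFun_apply_real] at this
    simp only [Complex.ofReal_mul]
    simp_rw [mul_comm (_ : ℂ) ((a i : ℝ) : ℂ)] at *
    rw [this]
    simp
    ring_nf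
  simp_rw [h, ← Complex.exp_sum, neg_div, Finset.sum_neg_distrib, ← Finset.sum_div]

/-- The joint law of finitely many linear functionals of a Gaussian vector is the centred Gaussian
law whose covariance is their Gram matrix. -/
lemma map_gaussPi_eq_multivariateGaussian {ι : Type*} [Fintype ι] [DecidableEq ι] {d : ℕ}
    (z : Matrix ι (Fin d) ℝ) :
    (gaussPi d).map (fun g ↦ toLp 2 (fun k ↦ dotv g (z k))) =
      multivariateGaussian 0 (z * zᵀ) := by
  have hS : (z * zᵀ).PosSemidef := by
    simpa using Matrix.posSemidef_self_mul_conjTranspose z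
  have hm : Measurable (fun g : Fin d → ℝ ↦ toLp 2 (fun k ↦ dotv g (z k))) := by
    unfold dotv; fun_prop
  have := Measure.isProbabilityMeasure_map (μ := gaussPi d) hm.aemeasurable
  apply Measure.ext_of_charFun
  ext t
  rw [charFun_multivariateGaussian hS, charFun_apply,
    integral_map hm.aemeasurable (by fun_prop)]
  have h (g : Fin d → ℝ) : ⟪toLp 2 (fun k ↦ dotv g (z k)), t⟫ = dotv g (ofLp t ᵥ* z) := by
    simp only [PiLp.inner_apply, dotv, vecMul, dotProduct, RCLike.inner_apply, conj_trivial,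
      Finset.mul_sum]
    rw [Finset.sum_comm]
    refine Finset.sum_congr rfl fun _ _ ↦ Finset.sum_congr rfl fun _ _ ↦ by ring
  simp_rw [h]
  rw [integral_cexp_dotv_gaussPi]
  have h2 : dotv (ofLp t ᵥ* z) (ofLp t ᵥ* z) = ofLp t ⬝ᵥ (z * zᵀ) *ᵥ ofLp t := by
    change (ofLp t ᵥ* z) ⬝ᵥ (ofLp t ᵥ* z) = _
    rw [← mulVec_mulVec, dotProduct_mulVec, mulVec_transpose]
  rw [h2]
  simp [neg_div]

/-- Independent Gaussian vectors have jointly standard Gaussian coordinates along an orthonormal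
family. -/
lemma map_pi_gaussPi_eq_stdGaussian {α κ : Type*} [Fintype α] [Fintype κ] [DecidableEq κ] {d : ℕ}
    (x : Matrix κ (Fin d) ℝ) (hx : x * xᵀ = 1) :
    (Measure.pi fun _ : α ↦ gaussPi d).map
      (fun r ↦ toLp 2 (fun p : α × κ ↦ dotv (r p.1) (x p.2))) =
      stdGaussian (EuclideanSpace ℝ (α × κ)) := by
  have hm : Measurable (fun r : α → Fin d → ℝ ↦
      toLp 2 (fun p : α × κ ↦ dotv (r p.1) (x p.2))) := by
    unfold dotv; fun_prop
  have := Measure.isProbabilityMeasure_map (μ := Measure.pi fun _ : α ↦ gaussPi d) hm.aemeasurable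
  apply Measure.ext_of_charFun
  ext t
  rw [charFun_stdGaussian, charFun_apply, integral_map hm.aemeasurable (by fun_prop)]
  have h (r : α → Fin d → ℝ) : ⟪toLp 2 (fun p : α × κ ↦ dotv (r p.1) (x p.2)), t⟫ =
      ∑ i, dotv (r i) ((fun k ↦ t (i, k)) ᵥ* x) := by
    simp only [PiLp.inner_apply, dotv, vecMul, dotProduct, RCLike.inner_apply, conj_trivial,
      Finset.mul_sum, Fintype.sum_prod_type]
    refine Finset.sum_congr rfl fun _ _ ↦ ?_
    rw [Finset.sum_comm]
    refine Finset.sum_congr rfl fun _ _ ↦ Finset.sum_congr rfl fun _ _ ↦ by ring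
  have h2 (i : α) : dotv ((fun k ↦ t (i, k)) ᵥ* x) ((fun k ↦ t (i, k)) ᵥ* x) =
      ∑ k, t (i, k) ^ 2 := by
    change ((fun k ↦ t (i, k)) ᵥ* x) ⬝ᵥ ((fun k ↦ t (i, k)) ᵥ* x) = _
    rw [← dotProduct_mulVec, ← mulVec_transpose, mulVec_mulVec, hx, one_mulVec]
    simp [dotProduct, sq]
  simp_rw [h, Complex.ofReal_sum, Finset.sum_mul, Complex.exp_sum]
  rw [integral_fintype_prod_eq_prod
    (f := fun i (x' : Fin d → ℝ) ↦
      Complex.exp (((dotv x' ((fun k ↦ t (i, k)) ᵥ* x) : ℝ) : ℂ) * Complex.I))]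
  simp_rw [integral_cexp_dotv_gaussPi, h2, ← Complex.exp_sum, ← Complex.ofReal_pow,
    EuclideanSpace.real_norm_sq_eq, Fintype.sum_prod_type, neg_div, Finset.sum_neg_distrib,
    ← Finset.sum_div, Complex.ofReal_sum]

/-- The square root of a positive semidefinite matrix is at least as close to the identity as the
matrix itself. -/
lemma norm_sqrt_apply_sub_le {ι : Type*} [Fintype ι] [DecidableEq ι] {S : Matrix ι ι ℝ}
    (hS : S.PosSemidef) (x : EuclideanSpace ℝ ι) :
    ‖toEuclideanCLM (𝕜 := ℝ) (CFC.sqrt S) x - x‖ ≤ ‖toEuclideanCLM (𝕜 := ℝ) S x - x‖ := by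
  set Q := CFC.sqrt S with hQ
  set y := toEuclideanCLM (𝕜 := ℝ) Q x - x with hy
  have hQQ : Q * Q = S := CFC.sqrt_mul_sqrt_self _ hS.nonneg
  have hQp : Q.PosSemidef := Matrix.nonneg_iff_posSemidef.1 (CFC.sqrt_nonneg S)
  have h1 : toEuclideanCLM (𝕜 := ℝ) S x - x = toEuclideanCLM (𝕜 := ℝ) Q y + y := by
    rw [← hQQ, map_mul, hy, map_sub]
    simp
  have h2 : 0 ≤ ⟪y, toEuclideanCLM (𝕜 := ℝ) Q y⟫ := by
    rw [inner_toEuclideanCLM]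
    simpa using hQp.dotProduct_mulVec_nonneg (ofLp y)
  rw [h1]
  have h3 : ‖y‖ * ‖y‖ ≤ ‖y‖ * ‖toEuclideanCLM (𝕜 := ℝ) Q y + y‖ := by
    calc ‖y‖ * ‖y‖ ≤ ⟪y, toEuclideanCLM (𝕜 := ℝ) Q y + y⟫ := by
          rw [inner_add_right, real_inner_self_eq_norm_mul_norm]; linarith
      _ ≤ _ := real_inner_le_norm _ _
  rcases (norm_nonneg y).eq_or_lt with h | h
  · rw [← h]; exact norm_nonneg _
  · exact le_of_mul_le_mul_left h3 h

lemma norm_toEuclideanCLM_sub_le {ι : Type*} [Fintype ι] [DecidableEq ι] {S : Matrix ι ι ℝ}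
    {ε : ℝ} (hε : 0 ≤ ε) (h : ∀ p q, |S p q - (1 : Matrix ι ι ℝ) p q| ≤ ε)
    (x : EuclideanSpace ℝ ι) :
    ‖toEuclideanCLM (𝕜 := ℝ) S x - x‖ ≤ Fintype.card ι * ε * ‖x‖ := by
  have hp (p : ι) : (toEuclideanCLM (𝕜 := ℝ) S x - x) p ^ 2 ≤ Fintype.card ι * ε ^ 2 * ‖x‖ ^ 2 := by
    have : (toEuclideanCLM (𝕜 := ℝ) S x - x) p = ∑ q, (S p q - (1 : Matrix ι ι ℝ) p q) * x q := by
      simp [sub_mul, Matrix.one_apply, mulVec, dotProduct]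
    rw [this, EuclideanSpace.real_norm_sq_eq]
    refine (Finset.sum_mul_sq_le_sq_mul_sq _ _ _).trans ?_
    gcongr
    calc ∑ q, (S p q - (1 : Matrix ι ι ℝ) p q) ^ 2 ≤ ∑ _q : ι, ε ^ 2 :=
          Finset.sum_le_sum fun q _ ↦ sq_le_sq' (neg_le_of_abs_le (h p q)) (le_of_abs_le (h p q))
      _ = _ := by simp
  refine abs_le_of_sq_le_sq' ?_ (by positivity) |>.2
  rw [EuclideanSpace.real_norm_sq_eq]
  calc _ ≤ ∑ _p : ι, Fintype.card ι * ε ^ 2 * ‖x‖ ^ 2 := Finset.sum_le_sum fun p _ ↦ hp p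
    _ = _ := by simp; ring

/-- Small ball estimate for one-dimensional projections of a standard Gaussian vector. -/
lemma stdGaussian_abs_inner_le {E : Type*} [NormedAddCommGroup E] [InnerProductSpace ℝ E]
    [FiniteDimensional ℝ E] [MeasurableSpace E] [BorelSpace E] {u : E} (hu : u ≠ 0) (ρ : ℝ) :
    stdGaussian E {x | |⟪u, x⟫| ≤ ρ * ‖u‖} ≤ ENNReal.ofReal (2 * ρ) := by
  have hu' : 0 < ‖u‖ := norm_pos_iff.2 hu
  set L : StrongDual ℝ E := innerSL ℝ (‖u‖⁻¹ • u)
  have hL : ‖L‖ = 1 := by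
    rw [innerSL_apply_norm, norm_smul, norm_inv, norm_norm, inv_mul_cancel₀ hu'.ne']
  have hlaw : (stdGaussian E).map L = gaussianReal 0 1 := by
    rw [IsGaussian.map_eq_gaussianReal, integral_strongDual_stdGaussian, variance_dual_stdGaussian,
      hL]
    simp
  have hset : {x : E | |⟪u, x⟫| ≤ ρ * ‖u‖} = L ⁻¹' (Set.Icc (-ρ) ρ) := by
    ext x
    simp only [Set.mem_ofPred_eq, Set.mem_preimage, Set.mem_Icc, ← abs_le, L, innerSL_apply_apply,
      real_inner_smul_left, abs_mul, abs_inv, abs_norm]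
    rw [inv_mul_le_iff₀ hu', mul_comm]
  rw [hset, ← Measure.map_apply (by fun_prop) measurableSet_Icc, hlaw,
    gaussianReal_apply _ one_ne_zero]
  calc ∫⁻ x in Set.Icc (-ρ) ρ, gaussianPDF 0 1 x ≤ ∫⁻ _x in Set.Icc (-ρ) ρ, 1 := by
        refine lintegral_mono fun x ↦ ?_
        rw [gaussianPDF, ENNReal.ofReal_le_one, gaussianPDFReal]
        have h1 : (√(2 * π * ((1 : NNReal) : ℝ)))⁻¹ ≤ 1 := by
          refine inv_le_one_of_one_le₀ ?_
          rw [Real.one_le_sqrt]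
          push_cast
          linarith [Real.pi_gt_three]
        have h2 : rexp (-(x - 0) ^ 2 / (2 * ((1 : NNReal) : ℝ))) ≤ 1 := by
          rw [Real.exp_le_one_iff]
          exact div_nonpos_of_nonpos_of_nonneg (neg_nonpos.2 (sq_nonneg _)) (by simp)
        exact mul_le_one₀ h1 (Real.exp_nonneg _) h2
    _ = ENNReal.ofReal (2 * ρ) := by rw [setLIntegral_one, Real.volume_Icc]; ring_nf

/-- The empirical mean of the products of the step responses to the linear forms with coefficients
`a` and `b`. -/
def pairMean (m : ℕ) (a b : Fin 2 → ℝ) (z : EuclideanSpace ℝ (Fin m × Fin 2)) : ℝ :=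
  (1 / (m : ℝ)) * ∑ i, heaviside (∑ k, a k * z (i, k)) * heaviside (∑ k, b k * z (i, k))

@[fun_prop]
lemma measurable_heaviside : Measurable heaviside :=
  Measurable.ite measurableSet_Ici measurable_const measurable_const

lemma heaviside_mem_Icc (x : ℝ) : heaviside x ∈ Set.Icc (0 : ℝ) 1 := by
  unfold heaviside; split_ifs <;> simp

lemma heaviside_eq_of_abs_sub_lt {x y : ℝ} (h : |y - x| < |x|) : heaviside y = heaviside x := by
  unfold heaviside
  rcases abs_cases x with ⟨h1, h2⟩ | ⟨h1, h2⟩ <;> rw [h1, abs_lt] at h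
  · rw [if_pos h2, if_pos (by linarith)]
  · rw [if_neg (by linarith), if_neg (by linarith)]

lemma measurable_pairMean (m : ℕ) (a b : Fin 2 → ℝ) : Measurable (pairMean m a b) := by
  unfold pairMean; fun_prop

/-- The vector representing the linear form with coefficients `a` on the `i`-th block. -/
def blockVec {m : ℕ} (a : Fin 2 → ℝ) (i : Fin m) : EuclideanSpace ℝ (Fin m × Fin 2) :=
  toLp 2 fun p ↦ if p.1 = i then a p.2 else 0

lemma inner_blockVec {m : ℕ} (a : Fin 2 → ℝ) (i : Fin m) (z : EuclideanSpace ℝ (Fin m × Fin 2)) :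
    ⟪blockVec a i, z⟫ = ∑ k, a k * z (i, k) := by
  simp only [blockVec, PiLp.inner_apply, RCLike.inner_apply, conj_trivial, Fintype.sum_prod_type]
  rw [Finset.sum_eq_single i]
  · simp [mul_comm]
  · intro j _ hj; simp [hj]
  · simp

lemma blockVec_ne_zero {m : ℕ} {a : Fin 2 → ℝ} (ha : a ≠ 0) (i : Fin m) : blockVec a i ≠ 0 := by
  obtain ⟨k, hk⟩ := Function.ne_iff.1 ha
  intro h
  have := congrArg (fun z : EuclideanSpace ℝ (Fin m × Fin 2) ↦ z (i, k)) h
  simp [blockVec] at this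
  exact hk this

lemma exists_stdGaussian_norm_gt_le (E : Type*) [NormedAddCommGroup E] [InnerProductSpace ℝ E]
    [FiniteDimensional ℝ E] [MeasurableSpace E] [BorelSpace E] {δ : ℝ} (hδ : 0 < δ) :
    ∃ R : ℝ, 0 < R ∧ stdGaussian E {x | R < ‖x‖} ≤ ENNReal.ofReal δ := by
  have h : Filter.Tendsto (fun R : ℝ ↦ stdGaussian E {x | R < ‖x‖}) Filter.atTop (nhds 0) := by
    have h0 : (⋂ R : ℝ, {x : E | R < ‖x‖}) = ∅ := by
      ext x
      simp only [Set.mem_iInter, Set.mem_ofPred_eq, Set.mem_empty_iff_false, iff_false, not_forall]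
      exact ⟨‖x‖, lt_irrefl _⟩
    have := tendsto_measure_iInter_atTop (μ := stdGaussian E) (s := fun R : ℝ ↦ {x | R < ‖x‖})
      (fun R ↦ (measurableSet_lt measurable_const measurable_norm).nullMeasurableSet)
      (fun R R' h x hx ↦ lt_of_le_of_lt h hx) ⟨0, measure_ne_top _ _⟩
    rwa [h0, measure_empty] at this
  obtain ⟨R, h1, h2⟩ := ((h.eventually (ge_mem_nhds (ENNReal.ofReal_pos.2 hδ))).and
    (Filter.eventually_gt_atTop 0)).exists
  exact ⟨R, h2, h1⟩

/-- Uniformly over the linear forms, the empirical mean computed from a centred Gaussian vector with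
covariance close to the identity has almost the same law as the one computed from a standard
Gaussian vector. -/
lemma exists_multivariateGaussian_pairMean_le {m : ℕ} (hm : 0 < m) {δ : ℝ} (hδ : 0 < δ) :
    ∃ ε : ℝ, 0 < ε ∧ ∀ S : Matrix (Fin m × Fin 2) (Fin m × Fin 2) ℝ, S.PosSemidef →
      (∀ p q, |S p q - (1 : Matrix (Fin m × Fin 2) (Fin m × Fin 2) ℝ) p q| ≤ ε) →
      ∀ a b : Fin 2 → ℝ, a ≠ 0 → b ≠ 0 → ∀ B : Set ℝ, MeasurableSet B →
      multivariateGaussian 0 S (pairMean m a b ⁻¹' B) ≤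
        stdGaussian (EuclideanSpace ℝ (Fin m × Fin 2)) (pairMean m a b ⁻¹' B) +
          ENNReal.ofReal δ := by
  set γ := stdGaussian (EuclideanSpace ℝ (Fin m × Fin 2)) with hγ
  obtain ⟨R, hR, hRδ⟩ := exists_stdGaussian_norm_gt_le (EuclideanSpace ℝ (Fin m × Fin 2))
    (half_pos hδ)
  have hm' : (0 : ℝ) < m := by exact_mod_cast hm
  refine ⟨δ / (8 * m * R) / (2 * m), by positivity, fun S hS hSε a b ha hb B hB ↦ ?_⟩
  set η := δ / (8 * m * R) with hη
  have hη0 : 0 < η := by positivity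
  set Q := toEuclideanCLM (𝕜 := ℝ) (CFC.sqrt S)
  have hQ (x) : ‖Q x - x‖ ≤ η * ‖x‖ := by
    refine (norm_sqrt_apply_sub_le hS x).trans ?_
    refine (norm_toEuclideanCLM_sub_le (by positivity) hSε x).trans_eq ?_
    simp only [Fintype.card_prod, Fintype.card_fin]
    push_cast
    field_simp
  have hlaw : multivariateGaussian 0 S (pairMean m a b ⁻¹' B) =
      γ (Q ⁻¹' (pairMean m a b ⁻¹' B)) := by
    rw [multivariateGaussian, Measure.map_apply (by fun_prop) (measurable_pairMean m a b hB)]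
    simp [Q, hγ]
  let flip (c : Fin 2 → ℝ) (i : Fin m) : Set (EuclideanSpace ℝ (Fin m × Fin 2)) :=
    {x | |⟪blockVec c i, x⟫| ≤ (η * R) * ‖blockVec c i‖}
  have hflip {c : Fin 2 → ℝ} (hc : c ≠ 0) (i : Fin m) :
      γ (flip c i) ≤ ENNReal.ofReal (δ / (4 * m)) := by
    refine (stdGaussian_abs_inner_le (blockVec_ne_zero hc i) (η * R)).trans_eq ?_
    congr 1
    rw [hη]
    field_simp
    norm_num
  have hstable {c : Fin 2 → ℝ} {i : Fin m} {x} (hx : ‖x‖ ≤ R) (hc : x ∉ flip c i) :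
      heaviside (∑ k, c k * Q x (i, k)) = heaviside (∑ k, c k * x (i, k)) := by
    rw [← inner_blockVec, ← inner_blockVec]
    apply heaviside_eq_of_abs_sub_lt
    rw [← inner_sub_right]
    simp only [flip, Set.mem_ofPred_eq, not_le] at hc
    refine lt_of_le_of_lt ((abs_real_inner_le_norm _ _).trans ?_) hc
    rw [mul_comm]
    gcongr
    exact (hQ x).trans (by gcongr)
  have hsub : Q ⁻¹' (pairMean m a b ⁻¹' B) ⊆ (pairMean m a b ⁻¹' B) ∪
      ({x | R < ‖x‖} ∪ ((⋃ i, flip a i) ∪ ⋃ i, flip b i)) := by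
    intro x hx
    by_contra hcon
    simp only [Set.mem_union, not_or, Set.mem_iUnion, not_exists] at hcon
    obtain ⟨h1, h2, h3, h4⟩ := hcon
    have h2' : ‖x‖ ≤ R := not_lt.1 h2
    apply h1
    have : pairMean m a b (Q x) = pairMean m a b x := by
      unfold pairMean
      congr 1
      exact Finset.sum_congr rfl fun i _ ↦ by rw [hstable h2' (h3 i), hstable h2' (h4 i)]
    rw [Set.mem_preimage, ← this]
    exact hx
  have hU {c : Fin 2 → ℝ} (hc : c ≠ 0) : γ (⋃ i, flip c i) ≤ ENNReal.ofReal (δ / 4) := by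
    refine (measure_iUnion_fintype_le _ _).trans ?_
    refine (Finset.sum_le_sum fun i _ ↦ hflip hc i).trans_eq ?_
    rw [Finset.sum_const, Finset.card_univ, Fintype.card_fin, nsmul_eq_mul,
      ← ENNReal.ofReal_natCast, ← ENNReal.ofReal_mul (by positivity)]
    congr 1
    field_simp
  rw [hlaw]
  calc γ (Q ⁻¹' (pairMean m a b ⁻¹' B))
      ≤ γ (pairMean m a b ⁻¹' B) +
        (γ {x | R < ‖x‖} + (γ (⋃ i, flip a i) + γ (⋃ i, flip b i))) :=
        (measure_mono hsub).trans <| (measure_union_le _ _).trans <| by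
          gcongr
          refine (measure_union_le _ _).trans ?_
          gcongr
          exact measure_union_le _ _
    _ ≤ γ (pairMean m a b ⁻¹' B) +
        (ENNReal.ofReal (δ / 2) + (ENNReal.ofReal (δ / 4) + ENNReal.ofReal (δ / 4))) := by
        gcongr
        exacts [hU ha, hU hb]
    _ = _ := by
        rw [← ENNReal.ofReal_add (by positivity) (by positivity),
          ← ENNReal.ofReal_add (by positivity) (by positivity)]
        congr 2
        ring

/-- Two-sided Hoeffding inequality for empirical means of `[0, 1]`-valued functions. -/
lemma hoeffding_pi_mean {E : Type*} [MeasurableSpace E] (μ : Measure E) [IsProbabilityMeasure μ]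
    {m : ℕ} (hm : 0 < m) {φ : E → ℝ} (hφ : Measurable φ) (hφI : ∀ x, φ x ∈ Set.Icc (0 : ℝ) 1)
    {s : ℝ} (hs : 0 ≤ s) :
    (Measure.pi fun _ : Fin m ↦ μ) {r | s < |(1 / (m : ℝ)) * ∑ i, φ (r i) -
      ∫ r : Fin m → E, (1 / (m : ℝ)) * ∑ i, φ (r i) ∂(Measure.pi fun _ : Fin m ↦ μ)|} ≤
      ENNReal.ofReal (2 * rexp (-2 * m * s ^ 2)) := by
  have hm' : (0 : ℝ) < m := by exact_mod_cast hm
  set P := Measure.pi fun _ : Fin m ↦ μ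
  set c := ∫ x, φ x ∂μ with hc
  have hint : Integrable φ μ := .of_mem_Icc 0 1 hφ.aemeasurable (.of_forall hφI)
  have hmean : ∫ r, (1 / (m : ℝ)) * ∑ i, φ (r i) ∂P = c := by
    rw [integral_const_mul, integral_finsetSum]
    · have (i : Fin m) : ∫ r, φ (r i) ∂P = c :=
        integral_comp_eval (μ := fun _ : Fin m ↦ μ) hint.aestronglyMeasurable
      simp_rw [this]
      simp
      field_simp
    · intro i _
      exact integrable_comp_eval (μ := fun _ : Fin m ↦ μ) hint
  rw [hmean]
  have hind : iIndepFun (fun (i : Fin m) (r : Fin m → E) ↦ φ (r i) - c) P :=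
    iIndepFun_pi (X := fun _ x ↦ φ x - c) fun _ ↦ (hφ.sub_const c).aemeasurable
  have hsub (i : Fin m) : HasSubgaussianMGF (fun r : Fin m → E ↦ φ (r i) - c) (1 / 4) P := by
    have h : HasSubgaussianMGF (fun x ↦ φ x - c) ((‖(1 : ℝ) - 0‖₊ / 2) ^ 2) μ :=
      hasSubgaussianMGF_of_mem_Icc hφ.aemeasurable (.of_forall hφI)
    have h2 : ((‖(1 : ℝ) - 0‖₊ / 2) ^ 2) = 1 / 4 := by
      rw [sub_zero, nnnorm_one]; norm_num
    have hmap : P.map (fun r : Fin m → E ↦ r i) = μ :=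
      (measurePreserving_eval (fun _ : Fin m ↦ μ) i).map_eq
    rw [h2, ← hmap] at h
    exact HasSubgaussianMGF.of_map (Y := fun r : Fin m → E ↦ r i) (X := fun x ↦ φ x - c)
      (measurable_pi_apply (X := fun _ : Fin m ↦ E) i).aemeasurable h
  have key (Y : Fin m → (Fin m → E) → ℝ) (hY : iIndepFun Y P)
      (hY2 : ∀ i, HasSubgaussianMGF (Y i) (1 / 4) P) :
      P {r | m * s ≤ ∑ i, Y i r} ≤ ENNReal.ofReal (rexp (-2 * m * s ^ 2)) := by
    have := HasSubgaussianMGF.measure_sum_ge_le_of_iIndepFun hY (c := fun _ ↦ 1 / 4)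
      (s := Finset.univ) (fun i _ ↦ hY2 i) (ε := m * s) (by positivity)
    rw [← ofReal_measureReal]
    refine ENNReal.ofReal_le_ofReal (this.trans_eq ?_)
    congr 1
    simp
    field_simp
    ring
  have hind' : iIndepFun (fun (i : Fin m) (r : Fin m → E) ↦ -(φ (r i) - c)) P :=
    hind.comp (fun _ x ↦ -x) fun _ ↦ measurable_neg
  have hincl : {r : Fin m → E | s < |(1 / (m : ℝ)) * ∑ i, φ (r i) - c|} ⊆
      {r | m * s ≤ ∑ i, (φ (r i) - c)} ∪ {r | m * s ≤ ∑ i, -(φ (r i) - c)} := by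
    intro r hr
    simp only [Set.mem_ofPred_eq] at hr
    have h1 : ∑ i, (φ (r i) - c) = m * ((1 / (m : ℝ)) * ∑ i, φ (r i) - c) := by
      rw [Finset.sum_sub_distrib]; simp; field_simp
    rcases lt_abs.1 hr with h | h
    · left
      simp only [Set.mem_ofPred_eq]
      rw [h1]
      gcongr
    · right
      simp only [Set.mem_ofPred_eq]
      rw [Finset.sum_neg_distrib, h1, ← mul_neg]
      gcongr
  refine (measure_mono hincl).trans ((measure_union_le _ _).trans ?_)
  refine (add_le_add (key _ hind hsub) (key _ hind' fun i ↦ (hsub i).neg)).trans_eq ?_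
  rw [← ENNReal.ofReal_add (by positivity) (by positivity), two_mul]

instance isProbabilityMeasure_signM (n : ℕ) : IsProbabilityMeasure (signM n) := by
  unfold signM; infer_instance

lemma signOf_mul_self (b : Bool) : signOf b * signOf b = 1 := by cases b <;> simp [signOf]

lemma signOf_not (b : Bool) : signOf (!b) = -signOf b := by cases b <;> simp [signOf]

/-- Flipping one coin: a function which changes sign under this has mean zero. -/
lemma integral_signM_eq_zero {n : ℕ} (c : Fin n) {f : (Fin n → Bool) → ℝ}
    (h : ∀ d, f (Function.update d c (!d c)) = -f d) : ∫ d, f d ∂(signM n) = 0 := by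
  have hinv : Function.Involutive fun d : Fin n → Bool ↦ Function.update d c (!d c) := by
    intro d; simp
  have hsum : ∑ d, f d = 0 := by
    have h1 := Equiv.sum_comp (Function.Involutive.toPerm _ hinv) f
    have h2 : ∑ d, f (Function.Involutive.toPerm _ hinv d) = -∑ d, f d := by
      rw [← Finset.sum_neg_distrib]
      exact Finset.sum_congr rfl fun d _ ↦ h d
    linarith
  rw [signM, PMF.integral_eq_sum]
  simp only [PMF.uniformOfFintype_apply, smul_eq_mul]
  rw [← Finset.mul_sum, hsum, mul_zero]

lemma integral_signOf_mul_signOf {n : ℕ} {p q : Fin n × Fin n} (hp : p.1 ≠ p.2) (hq : q.1 ≠ q.2) :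
    ∫ d, (signOf (d p.1) * signOf (d p.2)) * (signOf (d q.1) * signOf (d q.2)) ∂(signM n) =
      (if p = q then 1 else 0) + if p = q.swap then 1 else 0 := by
  obtain ⟨a, b⟩ := p
  obtain ⟨c, e⟩ := q
  simp only [ne_eq, Prod.mk.injEq, Prod.swap_prod_mk] at *
  by_cases hac : a = c
  · subst hac
    by_cases hbe : b = e
    · subst hbe
      have (d : Fin n → Bool) :
          (signOf (d a) * signOf (d b)) * (signOf (d a) * signOf (d b)) = 1 := by
        rw [mul_mul_mul_comm, signOf_mul_self, signOf_mul_self, one_mul]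
      simp_rw [this]
      simp [hp]
    · rw [integral_signM_eq_zero b]
      · simp [hbe, hq]
      · intro d
        simp [Function.update_of_ne hp, Function.update_of_ne (Ne.symm hbe), signOf_not]
  · by_cases hae : a = e
    · subst hae
      by_cases hbc : b = c
      · subst hbc
        have (d : Fin n → Bool) :
            (signOf (d a) * signOf (d b)) * (signOf (d b) * signOf (d a)) = 1 := by
          rw [mul_comm (signOf (d b)), mul_mul_mul_comm, signOf_mul_self, signOf_mul_self, one_mul]
        simp_rw [this]
        simp [hp]
      · rw [integral_signM_eq_zero b]
        · simp [hac, hbc]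
        · intro d
          simp [Function.update_of_ne hp, Function.update_of_ne (Ne.symm hbc), signOf_not]
    · rw [integral_signM_eq_zero a]
      · simp [hac, hae]
      · intro d
        simp [Function.update_of_ne (Ne.symm hp), Function.update_of_ne (Ne.symm hac),
          Function.update_of_ne (Ne.symm hae), signOf_not]

/-- Second moment of an off-diagonal quadratic chaos in random signs. -/
lemma integral_sq_chaos_le {n : ℕ} (M : Fin n × Fin n → ℝ) (hM : ∀ c, M (c, c) = 0) :
    ∫ d, (∑ p, M p * (signOf (d p.1) * signOf (d p.2))) ^ 2 ∂(signM n) ≤ 2 * ∑ p, M p ^ 2 := by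
  have hexp (d : Fin n → Bool) : (∑ p, M p * (signOf (d p.1) * signOf (d p.2))) ^ 2 =
      ∑ p, ∑ q, M p * M q *
        ((signOf (d p.1) * signOf (d p.2)) * (signOf (d q.1) * signOf (d q.2))) := by
    rw [sq, Finset.sum_mul_sum]
    refine Finset.sum_congr rfl fun _ _ ↦ Finset.sum_congr rfl fun _ _ ↦ by ring
  simp_rw [hexp]
  rw [integral_finsetSum _ fun _ _ ↦ .of_finite]
  simp_rw [integral_finsetSum Finset.univ fun _ _ ↦ Integrable.of_finite, integral_const_mul]
  have hpq (p q : Fin n × Fin n) : M p * M q * ∫ d,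
      (signOf (d p.1) * signOf (d p.2)) * (signOf (d q.1) * signOf (d q.2)) ∂(signM n) =
      M p * M q * ((if p = q then 1 else 0) + if p = q.swap then 1 else 0) := by
    by_cases hp : p.1 = p.2
    · obtain ⟨a, b⟩ := p
      obtain rfl : a = b := hp
      simp [hM]
    by_cases hq : q.1 = q.2
    · obtain ⟨a, b⟩ := q
      obtain rfl : a = b := hq
      simp [hM]
    rw [integral_signOf_mul_signOf hp hq]
  simp_rw [hpq]
  have hswap : ∑ p : Fin n × Fin n, M p.swap ^ 2 = ∑ p, M p ^ 2 :=
    (Equiv.prodComm _ _).sum_comp fun p ↦ M p ^ 2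
  calc _ = ∑ p, (M p ^ 2 + M p * M p.swap) := by
        refine Finset.sum_congr rfl fun p _ ↦ ?_
        have (q : Fin n × Fin n) : (p = q.swap) ↔ (p.swap = q) := by
          rw [Prod.swap_eq_iff_eq_swap]
        simp_rw [this, mul_add, Finset.sum_add_distrib]
        simp [sq]
    _ ≤ ∑ p, (M p ^ 2 + (M p ^ 2 + M p.swap ^ 2) / 2) := by
        refine Finset.sum_le_sum fun p _ ↦ ?_
        nlinarith [sq_nonneg (M p - M p.swap)]
    _ = _ := by
        rw [Finset.sum_add_distrib, ← Finset.sum_div, Finset.sum_add_distrib, hswap]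
        ring

/-- Fourth moment of a Rademacher sum. -/
lemma integral_rademacher_pow_four_le {n : ℕ} (a : Fin n → ℝ) :
    ∫ d, (∑ e, a e * signOf (d e)) ^ 4 ∂(signM n) ≤ 6 * (∑ e, a e ^ 2) ^ 2 := by
  set M : Fin n × Fin n → ℝ := fun p ↦ if p.1 = p.2 then 0 else a p.1 * a p.2 with hM
  have hsq (d : Fin n → Bool) : (∑ e, a e * signOf (d e)) ^ 2 =
      ∑ e, a e ^ 2 + ∑ p, M p * (signOf (d p.1) * signOf (d p.2)) := by
    rw [sq, Finset.sum_mul_sum, Fintype.sum_prod_type, ← Finset.sum_add_distrib]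
    refine Finset.sum_congr rfl fun c _ ↦ ?_
    have (e : Fin n) : a c * signOf (d c) * (a e * signOf (d e)) =
        (if c = e then a c ^ 2 else 0) + M (c, e) * (signOf (d c) * signOf (d e)) := by
      by_cases h : c = e
      · subst h
        simp only [hM, if_true, zero_mul, add_zero]
        linear_combination a c ^ 2 * signOf_mul_self (d c)
      · simp only [hM, if_neg h, zero_add]
        ring
    simp_rw [this, Finset.sum_add_distrib]
    simp
  have hMsq : ∑ p, M p ^ 2 ≤ (∑ e, a e ^ 2) ^ 2 := by
    rw [sq (∑ e, a e ^ 2), Finset.sum_mul_sum, Fintype.sum_prod_type]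
    refine Finset.sum_le_sum fun c _ ↦ Finset.sum_le_sum fun e _ ↦ ?_
    simp only [hM]
    split_ifs
    · rw [zero_pow two_ne_zero]
      positivity
    · rw [mul_pow]
  calc ∫ d, (∑ e, a e * signOf (d e)) ^ 4 ∂(signM n)
      ≤ ∫ d, (2 * (∑ e, a e ^ 2) ^ 2 +
          2 * (∑ p, M p * (signOf (d p.1) * signOf (d p.2))) ^ 2) ∂(signM n) := by
        refine integral_mono .of_finite .of_finite fun d ↦ ?_
        have : (∑ e, a e * signOf (d e)) ^ 4 = ((∑ e, a e * signOf (d e)) ^ 2) ^ 2 := by ring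
        simp only [this, hsq d]
        nlinarith [sq_nonneg (∑ e, a e ^ 2 - ∑ p, M p * (signOf (d p.1) * signOf (d p.2)))]
    _ = 2 * (∑ e, a e ^ 2) ^ 2 +
          2 * ∫ d, (∑ p, M p * (signOf (d p.1) * signOf (d p.2))) ^ 2 ∂(signM n) := by
        rw [integral_add .of_finite .of_finite, integral_const, probReal_univ, one_smul,
          integral_const_mul]
    _ ≤ _ := by
        have := integral_sq_chaos_le M fun c ↦ by simp [hM]
        linarith

/-- The vector `D₁ H D₀ v`. -/
def mixVec {n : ℕ} (H : Matrix (Fin n) (Fin n) ℝ) (d0 d1 : Fin n → Bool) (v : Fin n → ℝ) :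
    Fin n → ℝ :=
  fun c ↦ signOf (d1 c) * ∑ e, H c e * (signOf (d0 e) * v e)

/-- Every entry of the structured matrix is, up to sign, a coordinate of the budget vector; within
a row, and within a column, each coordinate is used at most once. -/
structure IsSignedSelection {t m n : ℕ} (A : (Fin t → ℝ) → Matrix (Fin m) (Fin n) ℝ)
    (idx : Fin m → Fin n → Fin t) (s : Fin m → Fin n → ℝ) : Prop where
  apply_eq : ∀ g i c, A g i c = s i c * g (idx i c)
  sign_sq : ∀ i c, s i c * s i c = 1
  row_injective : ∀ i, Function.Injective (idx i)
  col_injective : ∀ c, Function.Injective fun i ↦ idx i c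

/-- The coefficients, in terms of the budget vector, of the product of the `i`-th row with `w`. -/
def budgetVec {t m n : ℕ} (idx : Fin m → Fin n → Fin t) (s : Fin m → Fin n → ℝ)
    (w : Fin n → ℝ) (i : Fin m) : Fin t → ℝ :=
  fun e ↦ ∑ c, if idx i c = e then s i c * w c else 0

lemma IsSignedSelection.dotv_budgetVec {t m n : ℕ} {A : (Fin t → ℝ) → Matrix (Fin m) (Fin n) ℝ}
    {idx : Fin m → Fin n → Fin t} {s : Fin m → Fin n → ℝ} (hA : IsSignedSelection A idx s)
    (g : Fin t → ℝ) (w : Fin n → ℝ) (i : Fin m) :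
    dotv g (budgetVec idx s w i) = ∑ c, A g i c * w c := by
  simp only [dotv, budgetVec, Finset.mul_sum, mul_ite, mul_zero]
  rw [Finset.sum_comm]
  refine Finset.sum_congr rfl fun c _ ↦ ?_
  rw [hA.apply_eq]
  simp
  ring

lemma dotv_budgetVec_budgetVec {t m n : ℕ} (idx : Fin m → Fin n → Fin t) (s : Fin m → Fin n → ℝ)
    (w w' : Fin n → ℝ) (i j : Fin m) :
    dotv (budgetVec idx s w i) (budgetVec idx s w' j) =
      ∑ c, ∑ c', if idx i c = idx j c' then (s i c * w c) * (s j c' * w' c') else 0 := by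
  simp only [dotv, budgetVec, Finset.sum_mul_sum]
  rw [Finset.sum_comm]
  refine Finset.sum_congr rfl fun c _ ↦ ?_
  rw [Finset.sum_comm]
  refine Finset.sum_congr rfl fun c' _ ↦ ?_
  simp [ite_mul, eq_comm]

lemma IsSignedSelection.dotv_budgetVec_same_row {t m n : ℕ}
    {A : (Fin t → ℝ) → Matrix (Fin m) (Fin n) ℝ}
    {idx : Fin m → Fin n → Fin t} {s : Fin m → Fin n → ℝ} (hA : IsSignedSelection A idx s)
    (w w' : Fin n → ℝ) (i : Fin m) :
    dotv (budgetVec idx s w i) (budgetVec idx s w' i) = dotv w w' := by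
  rw [dotv_budgetVec_budgetVec, dotv]
  refine Finset.sum_congr rfl fun c _ ↦ ?_
  simp only [(hA.row_injective i).eq_iff, Finset.sum_ite_eq, Finset.mem_univ, if_true]
  linear_combination w c * w' c * hA.sign_sq i c

lemma dotv_mixVec {n : ℕ} {H : Matrix (Fin n) (Fin n) ℝ} (hH : H * Hᵀ = 1)
    (d0 d1 : Fin n → Bool) (v v' : Fin n → ℝ) :
    dotv (mixVec H d0 d1 v) (mixVec H d0 d1 v') = dotv v v' := by
  have hH' : Hᵀ * H = 1 := mul_eq_one_comm.1 hH
  set y : Fin n → ℝ := fun e ↦ signOf (d0 e) * v e with hy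
  set y' : Fin n → ℝ := fun e ↦ signOf (d0 e) * v' e with hy'
  calc dotv (mixVec H d0 d1 v) (mixVec H d0 d1 v') = (H *ᵥ y) ⬝ᵥ (H *ᵥ y') := by
        refine Finset.sum_congr rfl fun c _ ↦ ?_
        change signOf (d1 c) * (H *ᵥ y) c * (signOf (d1 c) * (H *ᵥ y') c) = _
        linear_combination (H *ᵥ y) c * (H *ᵥ y') c * signOf_mul_self (d1 c)
    _ = y ⬝ᵥ y' := by
        rw [dotProduct_mulVec, ← mulVec_transpose, mulVec_mulVec, hH', one_mulVec]
    _ = dotv v v' := by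
        refine Finset.sum_congr rfl fun c _ ↦ ?_
        simp only [hy, hy']
        linear_combination v c * v' c * signOf_mul_self (d0 c)

lemma integral_dotv_budgetVec_sq_le {t m n : ℕ} {A : (Fin t → ℝ) → Matrix (Fin m) (Fin n) ℝ}
    {idx : Fin m → Fin n → Fin t} {s : Fin m → Fin n → ℝ} (hA : IsSignedSelection A idx s)
    {i j : Fin m} (hij : i ≠ j) (u u' : Fin n → ℝ) :
    ∫ d, dotv (budgetVec idx s (fun c ↦ signOf (d c) * u c) i)
      (budgetVec idx s (fun c ↦ signOf (d c) * u' c) j) ^ 2 ∂(signM n) ≤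
      ∑ c, u c ^ 4 + ∑ c, u' c ^ 4 := by
  set M : Fin n × Fin n → ℝ := fun p ↦
    if idx i p.1 = idx j p.2 then (s i p.1 * u p.1) * (s j p.2 * u' p.2) else 0 with hM
  have h (d : Fin n → Bool) : dotv (budgetVec idx s (fun c ↦ signOf (d c) * u c) i)
      (budgetVec idx s (fun c ↦ signOf (d c) * u' c) j) =
      ∑ p, M p * (signOf (d p.1) * signOf (d p.2)) := by
    rw [dotv_budgetVec_budgetVec, Fintype.sum_prod_type]
    refine Finset.sum_congr rfl fun c _ ↦ Finset.sum_congr rfl fun c' _ ↦ ?_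
    simp only [hM, ite_mul, zero_mul]
    split_ifs
    · ring
    · rfl
  simp_rw [h]
  refine (integral_sq_chaos_le M fun c ↦ ?_).trans ?_
  · exact if_neg fun hc ↦ hij (hA.col_injective c hc)
  have hsum {α β γ : Type} [Fintype α] [Fintype β] [DecidableEq γ] (f : α → γ) {g : β → γ}
      (hg : Function.Injective g) (v : α → ℝ) (hv : ∀ c, 0 ≤ v c) :
      ∑ c, ∑ c', (if f c = g c' then v c else 0) ≤ ∑ c, v c := by
    refine Finset.sum_le_sum fun c _ ↦ ?_
    by_cases hc : ∃ b, f c = g b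
    · obtain ⟨b, hb⟩ := hc
      rw [Finset.sum_eq_single b]
      · simp [hb]
      · intro b' _ hb'
        rw [hb, if_neg fun h ↦ hb' (hg h).symm]
      · simp
    · rw [Finset.sum_eq_zero]
      · exact hv c
      · intro b _
        exact if_neg fun h ↦ hc ⟨b, h⟩
  have h1 := hsum (idx i) (hA.row_injective j) (fun c ↦ u c ^ 4) fun c ↦ by positivity
  have h2 := hsum (idx j) (hA.row_injective i) (fun c ↦ u' c ^ 4) fun c ↦ by positivity
  rw [Finset.sum_comm] at h2
  refine le_trans ?_ (add_le_add h1 h2)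
  rw [Fintype.sum_prod_type, Finset.mul_sum, ← Finset.sum_add_distrib]
  refine Finset.sum_le_sum fun c _ ↦ ?_
  rw [Finset.mul_sum, ← Finset.sum_add_distrib]
  refine Finset.sum_le_sum fun c' _ ↦ ?_
  simp only [hM, eq_comm (a := idx j c')]
  split_ifs
  · have e : ((s i c * u c) * (s j c' * u' c')) ^ 2 = u c ^ 2 * u' c' ^ 2 := by
      linear_combination u c ^ 2 * u' c' ^ 2 * (s j c') ^ 2 * hA.sign_sq i c +
        u c ^ 2 * u' c' ^ 2 * hA.sign_sq j c'
    rw [e]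
    nlinarith [sq_nonneg (u c ^ 2 - u' c' ^ 2)]
  · simp

lemma integral_hadamard_pow_four_le {n : ℕ} (hn : 0 < n) {H : Matrix (Fin n) (Fin n) ℝ}
    (hH : ∀ i j, |H i j| = 1 / √n) {v : Fin n → ℝ} (hv : dotv v v = 1) (c : Fin n) :
    ∫ d, (∑ e, H c e * (signOf (d e) * v e)) ^ 4 ∂(signM n) ≤ 6 / (n : ℝ) ^ 2 := by
  have h := integral_rademacher_pow_four_le fun e ↦ H c e * v e
  have hn' : (0 : ℝ) < n := by exact_mod_cast hn
  have h2 : ∑ e, (H c e * v e) ^ 2 = 1 / n := by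
    rw [← mul_one (1 / (n : ℝ))]
    nth_rewrite 2 [← hv]
    rw [dotv, Finset.mul_sum]
    refine Finset.sum_congr rfl fun e _ ↦ ?_
    rw [mul_pow, ← sq_abs (H c e), hH, div_pow, Real.sq_sqrt hn'.le]
    ring
  rw [h2] at h
  refine le_trans (le_of_eq ?_) (h.trans_eq (by ring))
  congr 1
  ext d
  congr 1
  exact Finset.sum_congr rfl fun _ _ ↦ by ring

/-- With high probability over the random signs, the Gram matrix of the structured projections of an
orthonormal pair is entrywise close to the identity. -/
lemma signM_gram_gt_le {t m n : ℕ} (hn : 0 < n) {A : (Fin t → ℝ) → Matrix (Fin m) (Fin n) ℝ}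
    {idx : Fin m → Fin n → Fin t} {s : Fin m → Fin n → ℝ} (hA : IsSignedSelection A idx s)
    {H : Matrix (Fin n) (Fin n) ℝ} (hH1 : H * Hᵀ = 1) (hH2 : ∀ i j, |H i j| = 1 / √n)
    {x : Matrix (Fin 2) (Fin n) ℝ} (hx : x * xᵀ = 1) {ε : ℝ} (hε : 0 < ε) :
    ((signM n).prod (signM n)) {d | ∃ p q : Fin m × Fin 2,
      ε < |dotv (budgetVec idx s (mixVec H d.1 d.2 (x p.2)) p.1)
        (budgetVec idx s (mixVec H d.1 d.2 (x q.2)) q.1) -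
          (1 : Matrix (Fin m × Fin 2) (Fin m × Fin 2) ℝ) p q|} ≤
      ENNReal.ofReal (48 * m ^ 2 / (n * ε ^ 2)) := by
  have hn' : (0 : ℝ) < n := by exact_mod_cast hn
  have hxx (k l : Fin 2) : dotv (x k) (x l) = (1 : Matrix (Fin 2) (Fin 2) ℝ) k l := by
    rw [← hx]; rfl
  set G : (Fin m × Fin 2) → (Fin m × Fin 2) → (Fin n → Bool) × (Fin n → Bool) → ℝ :=
    fun p q d ↦ dotv (budgetVec idx s (mixVec H d.1 d.2 (x p.2)) p.1)
      (budgetVec idx s (mixVec H d.1 d.2 (x q.2)) q.1) -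
      (1 : Matrix (Fin m × Fin 2) (Fin m × Fin 2) ℝ) p q with hG
  have hpq (p q : Fin m × Fin 2) :
      ((signM n).prod (signM n)) {d | ε < |G p q d|} ≤ ENNReal.ofReal (12 / (n * ε ^ 2)) := by
    obtain ⟨i, k⟩ := p
    obtain ⟨j, l⟩ := q
    by_cases hij : i = j
    · subst hij
      have h0 (d) : G (i, k) (i, l) d = 0 := by
        simp only [hG, hA.dotv_budgetVec_same_row, dotv_mixVec hH1, hxx, Matrix.one_apply,
          Prod.mk.injEq, true_and, sub_self]
      have : {d | ε < |G (i, k) (i, l) d|} = ∅ := by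
        ext d; simp [h0, hε.le]
      simp [this]
    · have hGd (d0 d1 : Fin n → Bool) : G (i, k) (j, l) (d0, d1) =
          dotv (budgetVec idx s (mixVec H d0 d1 (x k)) i)
            (budgetVec idx s (mixVec H d0 d1 (x l)) j) := by
        simp [hG, Matrix.one_apply, hij]
      have hint : ∫ d, G (i, k) (j, l) d ^ 2 ∂((signM n).prod (signM n)) ≤ 12 / n := by
        rw [integral_prod _ .of_finite]
        simp_rw [hGd]
        calc _ ≤ ∫ d, (∑ c, (∑ e, H c e * (signOf (d e) * x k e)) ^ 4 +
              ∑ c, (∑ e, H c e * (signOf (d e) * x l e)) ^ 4) ∂(signM n) :=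
              integral_mono .of_finite .of_finite fun d ↦
                integral_dotv_budgetVec_sq_le hA hij _ _
          _ ≤ ∑ _c : Fin n, 6 / (n : ℝ) ^ 2 + ∑ _c : Fin n, 6 / (n : ℝ) ^ 2 := by
              rw [integral_add .of_finite .of_finite, integral_finsetSum _ fun _ _ ↦ .of_finite,
                integral_finsetSum _ fun _ _ ↦ .of_finite]
              gcongr with c _ c _
              · exact integral_hadamard_pow_four_le hn hH2 (by simp [hxx]) c
              · exact integral_hadamard_pow_four_le hn hH2 (by simp [hxx]) c
          _ = 12 / n := by simp; field_simp; norm_num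
      have hmk := mul_meas_ge_le_integral_of_nonneg (μ := (signM n).prod (signM n))
        (f := fun d ↦ G (i, k) (j, l) d ^ 2) (.of_forall fun d ↦ sq_nonneg _) .of_finite (ε ^ 2)
      rw [← ofReal_measureReal]
      refine ENNReal.ofReal_le_ofReal ?_
      calc _ ≤ ((signM n).prod (signM n)).real {d | ε ^ 2 ≤ G (i, k) (j, l) d ^ 2} := by
            refine measureReal_mono fun d hd ↦ ?_
            simp only [Set.mem_ofPred_eq] at hd ⊢
            rw [← sq_abs (G _ _ _)]
            gcongr
        _ ≤ 12 / n / ε ^ 2 := by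
            rw [le_div_iff₀ (by positivity), mul_comm]
            exact hmk.trans hint
        _ = _ := by rw [div_div]
  have hset : {d | ∃ p q, ε < |G p q d|} = ⋃ p, ⋃ q, {d | ε < |G p q d|} := by
    ext d; simp
  rw [hset]
  refine (measure_iUnion_fintype_le _ _).trans ?_
  refine (Finset.sum_le_sum fun p _ ↦ (measure_iUnion_fintype_le _ _).trans
    (Finset.sum_le_sum fun q _ ↦ hpq p q)).trans_eq ?_
  simp only [Finset.sum_const, Finset.card_univ, Fintype.card_prod, Fintype.card_fin, nsmul_eq_mul]
  rw [← ENNReal.ofReal_natCast, ← ENNReal.ofReal_mul (by positivity),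
    ← ENNReal.ofReal_mul (by positivity)]
  congr 1
  push_cast
  ring

lemma exists_isSignedSelection_circMat {n m : ℕ} (hmn : m ≤ n) (hn : 0 < n) :
    ∃ idx s, IsSignedSelection (circMat n m hn) idx s := by
  refine ⟨fun i j ↦ ⟨((j : ℕ) + (n - (i : ℕ) % n)) % n,
    Nat.lt_of_lt_of_le (Nat.mod_lt _ hn) (Nat.le_add_right n m)⟩, fun _ _ ↦ 1,
    fun g i c ↦ by simp [circMat], by simp, fun i a b h ↦ ?_, fun c i j h ↦ ?_⟩
  · simp only [Fin.mk.injEq] at h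
    have h' : (a : ℕ) ≡ b [MOD n] := Nat.ModEq.add_right_cancel' _ h
    exact Fin.ext (Nat.ModEq.eq_of_lt_of_lt h' a.isLt b.isLt)
  · simp only [Fin.mk.injEq] at h
    have h' : n - (i : ℕ) % n ≡ n - (j : ℕ) % n [MOD n] := Nat.ModEq.add_left_cancel' _ h
    have hi : (i : ℕ) < n := i.isLt.trans_le hmn
    have hj : (j : ℕ) < n := j.isLt.trans_le hmn
    rw [Nat.mod_eq_of_lt hi, Nat.mod_eq_of_lt hj] at h'
    have h2 := h'.add_right ((i : ℕ) + j)
    have h3 : (n + j : ℕ) ≡ n + i [MOD n] := by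
      convert! h2 using 1 <;> omega
    exact Fin.ext (Nat.ModEq.eq_of_lt_of_lt (Nat.ModEq.add_left_cancel' _ h3) hj hi).symm

lemma exists_isSignedSelection_skewCircMat {n m : ℕ} (hmn : m ≤ n) (hn : 0 < n) :
    ∃ idx s, IsSignedSelection (skewCircMat n m hn) idx s := by
  refine ⟨fun i j ↦ if h : (i : ℕ) % n ≤ (j : ℕ) then
      ⟨(j : ℕ) - (i : ℕ) % n, by have hj := j.isLt; omega⟩
    else ⟨n + (j : ℕ) - (i : ℕ) % n, by have hi := Nat.mod_lt (i : ℕ) hn; omega⟩,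
    fun i j ↦ if (i : ℕ) % n ≤ (j : ℕ) then 1 else -1,
    fun g i c ↦ ?_, fun i c ↦ ?_, fun i a b h ↦ ?_, fun c i j h ↦ ?_⟩
  · simp only [skewCircMat]
    split_ifs <;> simp
  · split_ifs <;> simp
  · have hi := Nat.mod_lt (i : ℕ) hn
    apply Fin.ext
    have ha := a.isLt
    have hb := b.isLt
    split_ifs at h <;> simp only [Fin.mk.injEq] at h <;> omega
  · apply Fin.ext
    have hi : (i : ℕ) < n := i.isLt.trans_le hmn
    have hj : (j : ℕ) < n := j.isLt.trans_le hmn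
    have hc := c.isLt
    have hi' := Nat.mod_eq_of_lt hi
    have hj' := Nat.mod_eq_of_lt hj
    simp only at h
    split_ifs at h <;> simp only [Fin.mk.injEq] at h <;> omega

lemma exists_isSignedSelection_toepMat (n m : ℕ) :
    ∃ idx s, IsSignedSelection (toepMat n m) idx s := by
  refine ⟨fun i j ↦ ⟨m - 1 - (i : ℕ) + (j : ℕ),
    by have hi := i.isLt; have hj := j.isLt; omega⟩, fun _ _ ↦ 1,
    fun g i c ↦ by simp [toepMat], by simp, fun i a b h ↦ ?_, fun c i j h ↦ ?_⟩
  · simp only [Fin.mk.injEq] at h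
    exact Fin.ext (by omega)
  · simp only [Fin.mk.injEq] at h
    have hi := i.isLt
    have hj := j.isLt
    exact Fin.ext (by omega)

lemma exists_isSignedSelection_hankMat (n m : ℕ) :
    ∃ idx s, IsSignedSelection (hankMat n m) idx s := by
  refine ⟨fun i j ↦ ⟨(i : ℕ) + (j : ℕ),
    by have hi := i.isLt; have hj := j.isLt; omega⟩, fun _ _ ↦ 1,
    fun g i c ↦ by simp [hankMat], by simp, fun i a b h ↦ ?_, fun c i j h ↦ ?_⟩
  · simp only [Fin.mk.injEq] at h
    exact Fin.ext (by omega)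
  · simp only [Fin.mk.injEq] at h
    exact Fin.ext (by omega)

/-- Two linearly independent vectors are nonzero combinations of an orthonormal pair. -/
lemma exists_orthonormal_pair {n : ℕ} {v1 v2 : Fin n → ℝ} (h : LinearIndependent ℝ ![v1, v2]) :
    ∃ (x : Matrix (Fin 2) (Fin n) ℝ) (a b : Fin 2 → ℝ), x * xᵀ = 1 ∧ a ≠ 0 ∧ b ≠ 0 ∧
      v1 = a ᵥ* x ∧ v2 = b ᵥ* x := by
  set e := (WithLp.linearEquiv 2 ℝ (Fin n → ℝ)).symm
  set w : Fin 2 → EuclideanSpace ℝ (Fin n) := e ∘ ![v1, v2] with hw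
  have hli : LinearIndependent ℝ w := h.map' e.toLinearMap e.ker
  have hrank : Module.finrank ℝ (Submodule.span ℝ (Set.range w)) = 2 := by
    rw [finrank_span_eq_card hli]; simp
  set B := (stdOrthonormalBasis ℝ (Submodule.span ℝ (Set.range w))).reindex (finCongr hrank)
  let x : Matrix (Fin 2) (Fin n) ℝ := fun k ↦ ofLp (B k : EuclideanSpace ℝ (Fin n))
  have hmem (l : Fin 2) : ∃ c : Fin 2 → ℝ, ![v1, v2] l = c ᵥ* x := by
    have hl : w l ∈ Submodule.span ℝ (Set.range w) := Submodule.subset_span ⟨l, rfl⟩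
    refine ⟨fun k ↦ B.repr ⟨w l, hl⟩ k, ?_⟩
    have h1 := congrArg Subtype.val (B.sum_repr ⟨w l, hl⟩)
    ext j
    have h2 := congrArg (fun z : EuclideanSpace ℝ (Fin n) ↦ z j) h1
    simp only [AddSubmonoidClass.coe_finsetSum, Submodule.coe_smul] at h2
    simp only [vecMul, dotProduct, x]
    simpa [hw, e, Fin.sum_univ_two] using h2.symm
  obtain ⟨a, ha⟩ := hmem 0
  obtain ⟨b, hb⟩ := hmem 1
  refine ⟨x, a, b, ?_, ?_, ?_, ha, hb⟩
  · ext k l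
    have h1 := (orthonormal_iff_ite.1 B.orthonormal) k l
    rw [Submodule.coe_inner] at h1
    simp only [PiLp.inner_apply, RCLike.inner_apply, conj_trivial] at h1
    rw [Matrix.one_apply, ← h1, Matrix.mul_apply]
    exact Finset.sum_congr rfl fun j _ ↦ mul_comm (x k j) (x l j)
  · rintro rfl
    exact h.ne_zero 0 (by simpa using ha)
  · rintro rfl
    exact h.ne_zero 1 (by simpa using hb)

lemma dotv_vecMul {n : ℕ} {κ : Type*} [Fintype κ] (g : Fin n → ℝ) (a : κ → ℝ)
    (x : Matrix κ (Fin n) ℝ) : dotv g (a ᵥ* x) = ∑ k, a k * dotv g (x k) := by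
  simp only [dotv, vecMul, dotProduct, Finset.mul_sum]
  rw [Finset.sum_comm]
  exact Finset.sum_congr rfl fun k _ ↦ Finset.sum_congr rfl fun j _ ↦ by ring

lemma mixVec_vecMul {n : ℕ} {κ : Type*} [Fintype κ] (H : Matrix (Fin n) (Fin n) ℝ)
    (d0 d1 : Fin n → Bool) (a : κ → ℝ) (x : Matrix κ (Fin n) ℝ) :
    mixVec H d0 d1 (a ᵥ* x) = a ᵥ* fun k ↦ mixVec H d0 d1 (x k) := by
  ext c
  simp only [mixVec, vecMul, dotProduct, Finset.mul_sum]
  rw [Finset.sum_comm]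
  exact Finset.sum_congr rfl fun k _ ↦ Finset.sum_congr rfl fun j _ ↦ by ring

lemma IsSignedSelection.algEmb_eq {t m n : ℕ} {A : (Fin t → ℝ) → Matrix (Fin m) (Fin n) ℝ}
    {idx : Fin m → Fin n → Fin t} {s : Fin m → Fin n → ℝ} (hA : IsSignedSelection A idx s)
    (g : Fin t → ℝ) (H : Matrix (Fin n) (Fin n) ℝ) (d0 d1 : Fin n → Bool) (a : Fin 2 → ℝ)
    (x : Matrix (Fin 2) (Fin n) ℝ) (i : Fin m) :
    algEmb n m heaviside (A g) H d0 d1 (a ᵥ* x) i =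
      heaviside (∑ k, a k * dotv g (budgetVec idx s (mixVec H d0 d1 (x k)) i)) :=
  congrArg heaviside <| calc
    ∑ c, A g i c * mixVec H d0 d1 (a ᵥ* x) c
      = dotv (fun c ↦ A g i c) (a ᵥ* fun k ↦ mixVec H d0 d1 (x k)) := by rw [mixVec_vecMul]; rfl
    _ = ∑ k, a k * ∑ c, A g i c * mixVec H d0 d1 (x k) c := dotv_vecMul _ _ _
    _ = _ := Finset.sum_congr rfl fun k _ ↦ by rw [hA.dotv_budgetVec]

/-- A union bound over a finite discrete factor: a slicewise bound outside a bad set. -/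
lemma prod_le_add_of_slice_le {α β : Type*} [MeasurableSpace α] [MeasurableSpace β] [Fintype β]
    [MeasurableSingletonClass β] (μ : Measure α) [IsProbabilityMeasure μ] (ν : Measure β)
    [IsProbabilityMeasure ν] (E : Set (α × β)) (bad : Set β) {p : ENNReal}
    (h : ∀ d ∉ bad, μ {g | (g, d) ∈ E} ≤ p) : (μ.prod ν) E ≤ ν bad + p := by
  classical
  have hsub : E ⊆ Set.univ ×ˢ bad ∪
      ⋃ d ∈ (Finset.univ.filter fun d ↦ d ∉ bad), {g | (g, d) ∈ E} ×ˢ {d} := by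
    rintro ⟨g, d⟩ hgd
    by_cases hd : d ∈ bad
    · exact Or.inl ⟨trivial, hd⟩
    · refine Or.inr (Set.mem_biUnion (x := d) ?_ ⟨hgd, rfl⟩)
      simpa using hd
  calc (μ.prod ν) E ≤ (μ.prod ν) (Set.univ ×ˢ bad) + (μ.prod ν)
        (⋃ d ∈ (Finset.univ.filter fun d ↦ d ∉ bad), {g | (g, d) ∈ E} ×ˢ {d}) :=
        (measure_mono hsub).trans (measure_union_le _ _)
    _ ≤ ν bad + ∑ d ∈ (Finset.univ.filter fun d ↦ d ∉ bad), p * ν {d} := by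
        refine add_le_add (by simp [Measure.prod_prod]) ((measure_biUnion_finset_le _ _).trans ?_)
        refine Finset.sum_le_sum fun d hd ↦ ?_
        rw [Measure.prod_prod]
        gcongr
        exact h d (by simpa using hd)
    _ ≤ ν bad + p := by
        rw [← Finset.mul_sum, sum_measure_singleton]
        gcongr
        exact mul_le_of_le_one_right' prob_le_one

/-- The mean of the products of independent ideal projections. -/
def idealMean {m n : ℕ} (v1 v2 : Fin n → ℝ) (r : Fin m → Fin n → ℝ) : ℝ :=
  (1 / (m : ℝ)) * ∑ i, heaviside (dotv (r i) v1) * heaviside (dotv (r i) v2)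

lemma stdGaussian_pairMean_dist_le {m n : ℕ} (hm : 0 < m) {x : Matrix (Fin 2) (Fin n) ℝ}
    (hx : x * xᵀ = 1) (a b : Fin 2 → ℝ) {s : ℝ} (hs : 0 ≤ s) :
    stdGaussian (EuclideanSpace ℝ (Fin m × Fin 2)) (pairMean m a b ⁻¹' {y | s <
      |y - ∫ r, idealMean (a ᵥ* x) (b ᵥ* x) r ∂(Measure.pi fun _ : Fin m ↦ gaussPi n)|}) ≤
      ENNReal.ofReal (2 * rexp (-2 * m * s ^ 2)) := by
  have hB (c : ℝ) : MeasurableSet {y : ℝ | s < |y - c|} :=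
    measurableSet_lt measurable_const (by fun_prop)
  have hd (v : Fin n → ℝ) : Measurable fun r : Fin n → ℝ ↦ dotv r v := by
    unfold dotv; fun_prop
  have hmap : Measurable fun r : Fin m → Fin n → ℝ ↦
      (toLp 2 (fun p : Fin m × Fin 2 ↦ dotv (r p.1) (x p.2)) :
        EuclideanSpace ℝ (Fin m × Fin 2)) := by
    unfold dotv; fun_prop
  have : IsProbabilityMeasure (gaussPi n) := isProbabilityMeasure_gaussPi n
  rw [← map_pi_gaussPi_eq_stdGaussian x hx,
    Measure.map_apply hmap (measurable_pairMean m a b (hB _))]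
  have hφ : Measurable fun r : Fin n → ℝ ↦
      heaviside (dotv r (a ᵥ* x)) * heaviside (dotv r (b ᵥ* x)) :=
    (measurable_heaviside.comp (hd _)).mul (measurable_heaviside.comp (hd _))
  have key := hoeffding_pi_mean (gaussPi n) hm hφ (fun r ↦ ⟨mul_nonneg (heaviside_mem_Icc _).1
    (heaviside_mem_Icc _).1, mul_le_one₀ (heaviside_mem_Icc _).2 (heaviside_mem_Icc _).1
    (heaviside_mem_Icc _).2⟩) hs
  refine le_trans (le_of_eq ?_) key
  congr 1
  ext r
  simp only [Set.mem_preimage, Set.mem_ofPred_eq, pairMean, idealMean, dotv_vecMul]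

/-- For one pair of points and all sufficiently large dimensions, the structured estimate deviates
from its ideal mean with probability of the order of the Hoeffding bound. -/
lemma exists_forall_pair_deviation_le {m : ℕ} (hm : 0 < m) {s δ : ℝ} (hs : 0 ≤ s) (hδ : 0 < δ) :
    ∃ n0 : ℕ, ∀ n, n0 ≤ n → 0 < n → ∀ t, ∀ A : (Fin t → ℝ) → Matrix (Fin m) (Fin n) ℝ,
      (∃ idx σ, IsSignedSelection A idx σ) → ∀ H : Matrix (Fin n) (Fin n) ℝ, H * Hᵀ = 1 →
      (∀ i j, |H i j| = 1 / √n) → ∀ v1 v2, LinearIndependent ℝ ![v1, v2] →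
      ((gaussPi t).prod ((signM n).prod (signM n))) {ω | s <
        |(1 / (m : ℝ)) * ∑ i : Fin m, algEmb n m heaviside (A ω.1) H ω.2.1 ω.2.2 v1 i *
            algEmb n m heaviside (A ω.1) H ω.2.1 ω.2.2 v2 i -
          ∫ r, idealMean v1 v2 r ∂(Measure.pi fun _ : Fin m ↦ gaussPi n)|} ≤
      ENNReal.ofReal (2 * rexp (-2 * m * s ^ 2) + δ) := by
  obtain ⟨ε, hε, hG⟩ := exists_multivariateGaussian_pairMean_le hm (half_pos hδ)
  obtain ⟨n0, hn0⟩ := exists_nat_gt (48 * (m : ℝ) ^ 2 / ε ^ 2 / (δ / 2))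
  refine ⟨n0, fun n hn hn' t A ⟨idx, σ, hA⟩ H hH1 hH2 v1 v2 hv ↦ ?_⟩
  obtain ⟨x, a, b, hx, ha, hb, rfl, rfl⟩ := exists_orthonormal_pair hv
  have : IsProbabilityMeasure (gaussPi t) := isProbabilityMeasure_gaussPi t
  have : IsProbabilityMeasure (signM n) := isProbabilityMeasure_signM n
  have hnpos : (0 : ℝ) < n := by exact_mod_cast hn'
  have hbad : 48 * (m : ℝ) ^ 2 / (n * ε ^ 2) ≤ δ / 2 := by
    have h1 : 48 * (m : ℝ) ^ 2 / ε ^ 2 / (δ / 2) ≤ n := hn0.le.trans (by exact_mod_cast hn)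
    rw [div_le_iff₀ (half_pos hδ)] at h1
    rw [mul_comm (n : ℝ), ← div_div, div_le_iff₀ hnpos]
    linarith
  refine (prod_le_add_of_slice_le _ _ _ _ (p := ENNReal.ofReal (2 * rexp (-2 * m * s ^ 2)) +
    ENNReal.ofReal (δ / 2)) fun d hd ↦ ?_).trans
      ((add_le_add_left ((signM_gram_gt_le hn' hA hH1 hH2 hx hε).trans
        (ENNReal.ofReal_le_ofReal hbad)) _).trans (le_of_eq ?_))
  · set z : Matrix (Fin m × Fin 2) (Fin t) ℝ :=
      fun p ↦ budgetVec idx σ (mixVec H d.1 d.2 (x p.2)) p.1 with hz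
    set B : Set ℝ := {y | s <
      |y - ∫ r, idealMean (a ᵥ* x) (b ᵥ* x) r ∂(Measure.pi fun _ : Fin m ↦ gaussPi n)|}
    have hB : MeasurableSet B := measurableSet_lt measurable_const (by fun_prop)
    have hd' : ∀ p q, |(z * zᵀ) p q - (1 : Matrix (Fin m × Fin 2) (Fin m × Fin 2) ℝ) p q| ≤ ε := by
      simp only [Set.mem_ofPred_eq, not_exists, not_lt] at hd
      exact hd
    have hpsd : (z * zᵀ).PosSemidef := by
      simpa using Matrix.posSemidef_self_mul_conjTranspose z
    have hmap : Measurable fun g : Fin t → ℝ ↦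
        (toLp 2 (fun p : Fin m × Fin 2 ↦ dotv g (z p)) : EuclideanSpace ℝ (Fin m × Fin 2)) := by
      unfold dotv; fun_prop
    have h1 := hG _ hpsd hd' a b ha hb B hB
    rw [← map_gaussPi_eq_multivariateGaussian z,
      Measure.map_apply hmap (measurable_pairMean m a b hB)] at h1
    refine le_trans (le_of_eq ?_) (h1.trans
      (add_le_add_left (stdGaussian_pairMean_dist_le hm hx a b hs) _))
    congr 1
    ext g
    simp only [Set.mem_preimage, Set.mem_ofPred_eq, pairMean, hA.algEmb_eq, B, hz]
  · rw [← ENNReal.ofReal_add (by positivity) (by positivity),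
      ← ENNReal.ofReal_add (by positivity) (by positivity)]
    congr 1; ring

theorem angular_structured_concentration (τ : ℝ) (hτ1 : 0 < τ) (hτ2 : τ < 1 / 2) :
    ∃ C : ℝ, 0 < C ∧
    ∀ m N : ℕ, 0 < m →
    ∃ n0 : ℕ, ∀ n : ℕ, n0 ≤ n → ∀ hn : 0 < n,
    ∀ X : Finset (Fin n → ℝ), X.card = N →
    ∀ H : Matrix (Fin n) (Fin n) ℝ, H * H.transpose = 1 →
      (∀ i j, |H i j| = 1 / Real.sqrt n) →
    ∀ A : (Fin (n + m) → ℝ) → Matrix (Fin m) (Fin n) ℝ,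
      (A = circMat n m hn ∨ A = skewCircMat n m hn ∨ A = toepMat n m ∨ A = hankMat n m) →
      ((gaussPi (n + m)).prod ((signM n).prod (signM n)))
        {ω : (Fin (n + m) → ℝ) × ((Fin n → Bool) × (Fin n → Bool)) |
          ∃ v1 ∈ X, ∃ v2 ∈ X, LinearIndependent ℝ ![v1, v2] ∧
            (m : ℝ) ^ (-τ) + 1 / Real.log m <
              |(1 / (m : ℝ)) * ∑ i : Fin m,
                  algEmb n m heaviside (A ω.1) H ω.2.1 ω.2.2 v1 i *
                  algEmb n m heaviside (A ω.1) H ω.2.1 ω.2.2 v2 i -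
                ∫ r : Fin m → (Fin n → ℝ),
                  (1 / (m : ℝ)) * ∑ i : Fin m,
                    heaviside (dotv (r i) v1) * heaviside (dotv (r i) v2)
                  ∂(Measure.pi fun _ : Fin m => gaussPi n)|} ≤
      ENNReal.ofReal (C * N ^ 2 * Real.exp (-(m : ℝ) ^ (1 - 2 * τ))) := by
  refine ⟨3, by norm_num, fun m N hm ↦ ?_⟩
  have hm' : (0 : ℝ) < m := by exact_mod_cast hm
  obtain ⟨n0, hn0⟩ := exists_forall_pair_deviation_le hm (s := (m : ℝ) ^ (-τ)) (by positivity)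
    (Real.exp_pos (-(m : ℝ) ^ (1 - 2 * τ)))
  refine ⟨max n0 m, fun n hnn hn X hX H hH1 hH2 A hA ↦ ?_⟩
  have hmn : m ≤ n := (le_max_right _ _).trans hnn
  have hsel : ∃ idx σ, IsSignedSelection A idx σ := by
    rcases hA with rfl | rfl | rfl | rfl
    · exact exists_isSignedSelection_circMat hmn hn
    · exact exists_isSignedSelection_skewCircMat hmn hn
    · exact exists_isSignedSelection_toepMat n m
    · exact exists_isSignedSelection_hankMat n m
  have hlog : 0 ≤ 1 / Real.log m :=
    one_div_nonneg.2 (Real.log_nonneg (by exact_mod_cast hm))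
  have hpow : (m : ℝ) * ((m : ℝ) ^ (-τ)) ^ 2 = (m : ℝ) ^ (1 - 2 * τ) := by
    rw [← Real.rpow_natCast ((m : ℝ) ^ (-τ)), ← Real.rpow_mul hm'.le, ← Real.rpow_one_add' hm'.le]
    · congr 1; push_cast; ring
    · push_cast; linarith
  have hexp : 2 * rexp (-2 * m * ((m : ℝ) ^ (-τ)) ^ 2) + rexp (-(m : ℝ) ^ (1 - 2 * τ)) ≤
      3 * rexp (-(m : ℝ) ^ (1 - 2 * τ)) := by
    have h1 : rexp (-2 * m * ((m : ℝ) ^ (-τ)) ^ 2) ≤ rexp (-(m : ℝ) ^ (1 - 2 * τ)) := by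
      apply Real.exp_le_exp.2
      have : 0 ≤ (m : ℝ) ^ (1 - 2 * τ) := by positivity
      rw [mul_assoc, hpow]; linarith
    linarith
  set ev : (Fin n → ℝ) → (Fin n → ℝ) →
      Set ((Fin (n + m) → ℝ) × ((Fin n → Bool) × (Fin n → Bool))) := fun v1 v2 ↦
    {ω | (m : ℝ) ^ (-τ) <
        |(1 / (m : ℝ)) * ∑ i : Fin m, algEmb n m heaviside (A ω.1) H ω.2.1 ω.2.2 v1 i *
            algEmb n m heaviside (A ω.1) H ω.2.1 ω.2.2 v2 i -
          ∫ r, idealMean v1 v2 r ∂(Measure.pi fun _ : Fin m ↦ gaussPi n)|} with hev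
  classical
  refine (measure_mono (t := ⋃ v ∈ (X ×ˢ X).filter fun v ↦ LinearIndependent ℝ ![v.1, v.2],
    ev v.1 v.2) ?_).trans ?_
  · rintro ω ⟨v1, h1, v2, h2, hli, hlt⟩
    refine Set.mem_biUnion (x := (v1, v2)) (by simp [h1, h2, hli]) ?_
    exact (le_add_of_nonneg_right hlog).trans_lt hlt
  · calc _ ≤ ∑ v ∈ (X ×ˢ X).filter fun v ↦ LinearIndependent ℝ ![v.1, v.2],
          ENNReal.ofReal (3 * rexp (-(m : ℝ) ^ (1 - 2 * τ))) := by
          refine (measure_biUnion_finset_le _ _).trans (Finset.sum_le_sum fun v hv ↦ ?_)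
          exact (hn0 n ((le_max_left _ _).trans hnn) hn _ A hsel H hH1 hH2 v.1 v.2
            (Finset.mem_filter.1 hv).2).trans (ENNReal.ofReal_le_ofReal hexp)
      _ ≤ ∑ v ∈ X ×ˢ X, ENNReal.ofReal (3 * rexp (-(m : ℝ) ^ (1 - 2 * τ))) :=
          Finset.sum_le_sum_of_subset (Finset.filter_subset _ _)
      _ = _ := by
          rw [Finset.sum_const, Finset.card_product, hX, nsmul_eq_mul,
            ← ENNReal.ofReal_natCast, ← ENNReal.ofReal_mul (by positivity)]
          congr 1; push_cast; ring

end
end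

section
/- Suppose Ψ: ℝ^m → ℝ is a linear function and the P-model is normalized and satisfies the orthogonality condition (for every i, any two distinct columns of Pᵢ are orthogonal). Then the structured mechanism gives an unbiased estimator of Λ_f: for any v¹,…,v^k ∈ ℝⁿ (assuming all the relevant expectations exist), E[ Ψ(β(f(⟨a¹,v¹⟩),…,f(⟨a¹,v^k⟩)),…,β(f(⟨a^m,v¹⟩),…,f(⟨a^m,v^k⟩))) ] = Λ_f(v¹,…,v^k), where a¹,…,a^m are the rows of the structured matrix A and the expectation on the left is over the budget of randomness g. -/
open MeasureTheory ProbabilityTheory Real Finset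

noncomputable section

open Matrix in
/-- A matrix with orthonormal columns maps a standard Gaussian row vector to a standard Gaussian
row vector. -/
theorem measurePreserving_vecMul_gaussPi {t n : ℕ} {P : Matrix (Fin t) (Fin n) ℝ}
    (hP : Pᵀ * P = 1) :
    MeasurePreserving (fun g : Fin t → ℝ => g ᵥ* P) (gaussPi t) (gaussPi n) := by
  have hmeas : Measurable fun g : Fin t → ℝ => g ᵥ* P :=
    (continuous_id.matrix_vecMul continuous_const).measurable
  have : IsProbabilityMeasure (gaussPi t) := by unfold gaussPi; infer_instance
  have : IsProbabilityMeasure ((gaussPi t).map fun g => g ᵥ* P) :=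
    Measure.isProbabilityMeasure_map hmeas.aemeasurable
  refine ⟨hmeas, charFun_eq_pi_iff.mp fun s => ?_⟩
  have key : charFun (((gaussPi t).map fun g => g ᵥ* P).map (WithLp.toLp 2)) s =
      charFun ((gaussPi t).map (WithLp.toLp 2)) (WithLp.toLp 2 (P *ᵥ s.ofLp)) := by
    simp_rw [charFun_apply, ← MeasurableEquiv.coe_toLp, integral_map_equiv,
      MeasurableEquiv.coe_toLp]
    rw [integral_map hmeas.aemeasurable (Measurable.aestronglyMeasurable (by fun_prop))]
    simp only [EuclideanSpace.inner_eq_star_dotProduct, star_trivial]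
    refine integral_congr_ae (.of_forall fun g => ?_)
    simp only [dotProduct_comm _ (g ᵥ* P), dotProduct_comm _ g, dotProduct_mulVec]
  have hsq : ∑ l, (P *ᵥ s.ofLp) l ^ 2 = ∑ c, s c ^ 2 := by
    have h : (P *ᵥ s.ofLp) ⬝ᵥ (P *ᵥ s.ofLp) = s.ofLp ⬝ᵥ s.ofLp := by
      rw [dotProduct_mulVec, ← mulVec_transpose, mulVec_mulVec, hP, one_mulVec]
    simpa only [dotProduct, ← pow_two] using h
  rw [key, gaussPi, charFun_pi]
  simp only [charFun_gaussianReal, ← Complex.exp_sum]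
  congr 1
  simp only [Complex.ofReal_zero, mul_zero, zero_mul, zero_sub, NNReal.coe_one, Complex.ofReal_one,
    one_mul, sum_neg_distrib, ← sum_div]
  exact_mod_cast congrArg (fun x : ℝ => -((x : ℂ) / 2)) hsq

/-- If a linear combination of copies of `F` in independent variables is integrable, then so is
`F`, provided some coefficient does not vanish. -/
theorem integrable_of_integrable_sum_pi {α : Type*} [MeasurableSpace α] {μ : Measure α}
    [IsProbabilityMeasure μ] {m : ℕ} {F : α → ℝ} {w : Fin m → ℝ}
    (h : Integrable (fun r : Fin m → α => ∑ i, w i * F (r i)) (Measure.pi fun _ => μ))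
    {i : Fin m} (hi : w i ≠ 0) : Integrable F μ := by
  obtain _ | m := m
  · exact i.elim0
  have hprod : Integrable
      (fun p : α × (Fin m → α) => w i * F p.1 + ∑ j, w (i.succAbove j) * F (p.2 j))
      (μ.prod (Measure.pi fun _ => μ)) := by
    rw [← (measurePreserving_piFinSuccAbove (fun _ => μ) i).integrable_comp_emb
      (MeasurableEquiv.measurableEmbedding _)]
    refine h.congr (.of_forall fun r => ?_)
    simp [Fin.sum_univ_succAbove _ i, Fin.removeNth]
  obtain ⟨y, hy⟩ := hprod.prod_left_ae.exists
  have hwF : Integrable (fun x => w i * F x) μ := by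
    refine (hy.sub (integrable_const (∑ j, w (i.succAbove j) * F (y j)))).congr
      (.of_forall fun x => ?_)
    simp
  exact (integrable_const_mul_iff (isUnit_iff_ne_zero.mpr hi) F).mp hwF

/-- Unbiasedness lemma: if `Ψ` is linear and the `P`-model is normalized
and satisfies the orthogonality condition, then the structured mechanism (rows `aⁱ = g·Pᵢ`
of the structured matrix, for a standard Gaussian budget `g ∈ ℝᵗ`) gives an unbiased
estimator of `Λ_f(v¹,…,v^k)`. -/
theorem structured_unbiased (t n m k : ℕ)
    (P : Fin m → Matrix (Fin t) (Fin n) ℝ)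
    (hnorm : ∀ (i : Fin m) (c : Fin n), (∑ l, P i l c ^ 2) = 1)
    (horth : ∀ (i : Fin m) (c c' : Fin n), c ≠ c' → (∑ l, P i l c * P i l c') = 0)
    (f : ℝ → ℝ) (β : (Fin k → ℝ) → ℝ) (Ψ : (Fin m → ℝ) → ℝ)
    (hΨ : IsLinearMap ℝ Ψ)
    (v : Fin k → (Fin n → ℝ))
    (hint1 : Integrable
      (fun g : Fin t → ℝ =>
        Ψ fun i => β fun j => f (∑ c, (∑ l, g l * P i l c) * v j c))
      (gaussPi t))
    (hint2 : Integrable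
      (fun r : Fin m → (Fin n → ℝ) =>
        Ψ fun i => β fun j => f (dotv (r i) (v j)))
      (Measure.pi fun _ : Fin m => gaussPi n)) :
    ∫ g : Fin t → ℝ,
        Ψ (fun i => β fun j => f (∑ c, (∑ l, g l * P i l c) * v j c)) ∂(gaussPi t) =
    ∫ r : Fin m → (Fin n → ℝ),
        Ψ (fun i => β fun j => f (dotv (r i) (v j)))
      ∂(Measure.pi fun _ : Fin m => gaussPi n) := by
  have : ∀ d, IsProbabilityMeasure (gaussPi d) := fun d => by unfold gaussPi; infer_instance
  obtain ⟨w, hw⟩ : ∃ w : Fin m → ℝ, ∀ x, Ψ x = ∑ i, w i * x i := by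
    refine ⟨fun i => Ψ fun j => if i = j then 1 else 0, fun x => ?_⟩
    simpa [mul_comm] using (hΨ.mk' Ψ).pi_apply_eq_sum_univ x
  have hP : ∀ i, (P i).transpose * P i = 1 := fun i => by
    ext c c'
    obtain rfl | hc := eq_or_ne c c'
    · simpa [Matrix.mul_apply, ← pow_two] using hnorm i c
    · simpa [Matrix.mul_apply, hc] using horth i c c' hc
  have hmap := fun i => measurePreserving_vecMul_gaussPi (hP i)
  have heval := measurePreserving_eval fun _ : Fin m => gaussPi n
  set F : (Fin n → ℝ) → ℝ := fun x => β fun j => f (dotv x (v j))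
  have hleft : ∀ (g : Fin t → ℝ) (i : Fin m),
      (β fun j => f (∑ c, (∑ l, g l * P i l c) * v j c)) = F (Matrix.vecMul g (P i)) :=
    fun _ _ => rfl
  have hright : ∀ (r : Fin m → Fin n → ℝ) (i : Fin m),
      (β fun j => f (dotv (r i) (v j))) = F (r i) := fun _ _ => rfl
  simp only [hw, hleft, hright] at hint2 ⊢
  have hF : ∀ i, w i ≠ 0 → Integrable F (gaussPi n) := fun i hi =>
    integrable_of_integrable_sum_pi hint2 hi
  have hcomp : ∀ {Ω : Type} [MeasurableSpace Ω] {ν : Measure Ω} {T : Ω → Fin n → ℝ},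
      MeasurePreserving T ν (gaussPi n) → ∀ i, Integrable (fun ω => w i * F (T ω)) ν ∧
        ∫ ω, w i * F (T ω) ∂ν = w i * ∫ x, F x ∂(gaussPi n) := by
    intro Ω _ ν T hT i
    obtain hi | hi := eq_or_ne (w i) 0
    · simp [hi]
    · refine ⟨(hT.integrable_comp_of_integrable (hF i hi)).const_mul _, ?_⟩
      rw [integral_const_mul, ← hT.map_eq, integral_map hT.aemeasurable]
      rw [hT.map_eq]
      exact (hF i hi).aestronglyMeasurable
  rw [integral_finsetSum _ fun i _ => (hcomp (hmap i) i).1,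
    integral_finsetSum _ fun i _ => (hcomp (heval i) i).1]
  exact sum_congr rfl fun i _ => (hcomp (hmap i) i).2.trans (hcomp (heval i) i).2.symm

end
end

section
/- Let g be a standard Gaussian vector in ℝ², let u¹, u² ∈ ℝ² be nonzero vectors, and let ε > 0 and m ≥ 1. Then the probability that there exists e ∈ ℝ² with ‖e‖_∞ ≤ ε such that the pair of indicators (1_{⟨g+e, u¹⟩ ≥ 0}, 1_{⟨g+e, u²⟩ ≥ 0}) differs from (1_{⟨g, u¹⟩ ≥ 0}, 1_{⟨g, u²⟩ ≥ 0}) is at most 2√2·m·ε/π + 2/(π·m²). -/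
open MeasureTheory ProbabilityTheory Real

lemma exp_neg_le_quadratic {y : ℝ} (hy : 0 ≤ y) : exp (-y) ≤ 1 - y + y ^ 2 / 2 := by
  have h := quadratic_le_exp_of_nonneg hy
  have hpos : 0 < 1 + y + y ^ 2 / 2 := by positivity
  calc exp (-y) = (exp y)⁻¹ := exp_neg y
    _ ≤ (1 + y + y ^ 2 / 2)⁻¹ := inv_anti₀ hpos h
    _ ≤ 1 - y + y ^ 2 / 2 := by
      rw [inv_le_iff_one_le_mul₀ hpos]
      nlinarith [sq_nonneg (y ^ 2)]

lemma gaussianReal_real_Icc_neg {s : ℝ} (hs : 0 ≤ s) :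
    (gaussianReal 0 1).real (Set.Icc (-s) s) =
      (√(2 * π))⁻¹ * ∫ x in (-s)..s, exp (-(x ^ 2 / 2)) := by
  have hpdf : gaussianPDFReal 0 1 = fun x ↦ (√(2 * π))⁻¹ * exp (-(x ^ 2 / 2)) := by
    ext x
    simp [gaussianPDFReal, neg_div]
  rw [measureReal_def, gaussianReal_apply_eq_integral 0 one_ne_zero,
    ENNReal.toReal_ofReal (integral_nonneg fun x ↦ gaussianPDFReal_nonneg 0 1 x),
    integral_Icc_eq_integral_Ioc, ← intervalIntegral.integral_of_le (by linarith), hpdf,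
    intervalIntegral.integral_const_mul]

lemma gaussianReal_real_Icc_neg_le {s : ℝ} (hs : 0 ≤ s) :
    (gaussianReal 0 1).real (Set.Icc (-s) s) ≤
      (√(2 * π))⁻¹ * (2 * (s - s ^ 3 / 6 + s ^ 5 / 40)) := by
  rw [gaussianReal_real_Icc_neg hs]
  gcongr
  have hint : ∫ x in (-s)..s, (1 - x ^ 2 / 2 + x ^ 4 / 8) =
      2 * (s - s ^ 3 / 6 + s ^ 5 / 40) := by
    rw [intervalIntegral.integral_add, intervalIntegral.integral_sub]
    · simp [intervalIntegral.integral_div, integral_pow]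
      ring
    all_goals exact Continuous.intervalIntegrable (by fun_prop) _ _
  rw [← hint]
  refine intervalIntegral.integral_mono_on (by linarith)
    (Continuous.intervalIntegrable (by fun_prop) _ _)
    (Continuous.intervalIntegrable (by fun_prop) _ _) fun x _ ↦ ?_
  refine (exp_neg_le_quadratic (by positivity)).trans_eq ?_
  ring

lemma le_gaussianReal_real_Icc_neg {s : ℝ} (hs : 0 ≤ s) :
    (√(2 * π))⁻¹ * (2 * (s - s ^ 3 / 6)) ≤ (gaussianReal 0 1).real (Set.Icc (-s) s) := by
  rw [gaussianReal_real_Icc_neg hs]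
  gcongr
  have hint : ∫ x in (-s)..s, (1 - x ^ 2 / 2) = 2 * (s - s ^ 3 / 6) := by
    rw [intervalIntegral.integral_sub]
    · simp [intervalIntegral.integral_div, integral_pow]
      ring
    all_goals exact Continuous.intervalIntegrable (by fun_prop) _ _
  rw [← hint]
  refine intervalIntegral.integral_mono_on (by linarith)
    (Continuous.intervalIntegrable (by fun_prop) _ _)
    (Continuous.intervalIntegrable (by fun_prop) _ _) fun x _ ↦ ?_
  linarith [one_sub_le_exp_neg (x ^ 2 / 2)]

lemma pi_gaussianReal_map_linear_combination {a b : ℝ} (hab : a ^ 2 + b ^ 2 = 1) :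
    (Measure.pi fun _ : Fin 2 ↦ gaussianReal 0 1).map (fun g ↦ a * g 0 + b * g 1) =
      gaussianReal 0 1 := by
  have hlaw (c : ℝ) (i : Fin 2) :
      (Measure.pi fun _ : Fin 2 ↦ gaussianReal 0 1).map (fun g ↦ c * g i) =
        gaussianReal (c * 0) (NNReal.mk (c ^ 2) (sq_nonneg c) * 1) := by
    rw [← gaussianReal_map_const_mul]
    conv_rhs => rw [← (measurePreserving_eval (fun _ : Fin 2 ↦ gaussianReal 0 1) i).map_eq]
    rw [Measure.map_map (by fun_prop) (by fun_prop)]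
    rfl
  have hindep : IndepFun (fun g : Fin 2 → ℝ ↦ a * g 0) (fun g ↦ b * g 1)
      (Measure.pi fun _ : Fin 2 ↦ gaussianReal 0 1) := by
    have h := iIndepFun_pi (μ := fun _ : Fin 2 ↦ gaussianReal 0 1) (X := fun _ x ↦ x)
      (fun _ ↦ by fun_prop)
    exact (h.indepFun zero_ne_one).comp (φ := fun x ↦ a * x) (ψ := fun x ↦ b * x)
      (by fun_prop) (by fun_prop)
  have hsum := gaussianReal_add_gaussianReal_of_indepFun hindep (hlaw a 0) (hlaw b 1)
  have hvar : NNReal.mk (a ^ 2) (sq_nonneg a) * 1 + NNReal.mk (b ^ 2) (sq_nonneg b) * 1 = 1 :=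
    NNReal.eq (by simpa using hab)
  rw [hvar, mul_zero, mul_zero, add_zero] at hsum
  exact hsum

lemma abs_add_abs_le_sqrt_two_mul (a b : ℝ) : |a| + |b| ≤ √2 * √(a ^ 2 + b ^ 2) := by
  rw [← sqrt_mul zero_le_two]
  apply le_sqrt_of_sq_le
  nlinarith [sq_abs a, sq_abs b, sq_nonneg (|a| - |b|)]

lemma abs_linear_combination_le {ε x y a b : ℝ} (hx : |x| ≤ ε) (hy : |y| ≤ ε) :
    |a * x + b * y| ≤ √2 * ε * √(a ^ 2 + b ^ 2) := by
  have hε : 0 ≤ ε := (abs_nonneg x).trans hx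
  calc |a * x + b * y| ≤ |a| * |x| + |b| * |y| := by
        simpa only [abs_mul] using abs_add_le (a * x) (b * y)
    _ ≤ |a| * ε + |b| * ε := by gcongr
    _ = ε * (|a| + |b|) := by ring
    _ ≤ ε * (√2 * √(a ^ 2 + b ^ 2)) := by gcongr; exact abs_add_abs_le_sqrt_two_mul a b
    _ = √2 * ε * √(a ^ 2 + b ^ 2) := by ring

lemma abs_le_abs_sub_of_heaviside_ne {x y : ℝ}
    (h : (if 0 ≤ x then (1 : ℝ) else 0) ≠ if 0 ≤ y then 1 else 0) : |y| ≤ |x - y| := by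
  split_ifs at h with hx hy hy
  · exact absurd rfl h
  · rw [abs_of_neg (not_le.1 hy), abs_of_nonneg (by linarith)]
    linarith
  · rw [abs_of_nonneg hy, abs_of_neg (by linarith)]
    linarith
  · exact absurd rfl h

/-- The strip of half-width `s` orthogonal to `u`. -/
def strip (s : ℝ) (u : Fin 2 → ℝ) : Set (Fin 2 → ℝ) :=
  {g | |u 0 * g 0 + u 1 * g 1| ≤ s * √(u 0 ^ 2 + u 1 ^ 2)}

lemma measurableSet_strip (s : ℝ) (u : Fin 2 → ℝ) : MeasurableSet (strip s u) :=
  measurableSet_le (by fun_prop) (by fun_prop)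

lemma pi_gaussianReal_real_strip (s : ℝ) {u : Fin 2 → ℝ} (hu : u ≠ 0) :
    (Measure.pi fun _ : Fin 2 ↦ gaussianReal 0 1).real (strip s u) =
      (gaussianReal 0 1).real (Set.Icc (-s) s) := by
  have hpos : 0 < u 0 ^ 2 + u 1 ^ 2 := by
    refine lt_of_le_of_ne (by positivity) fun h ↦ hu ?_
    ext i
    fin_cases i <;> simp <;> nlinarith [sq_nonneg (u 0), sq_nonneg (u 1)]
  have hσ : 0 < √(u 0 ^ 2 + u 1 ^ 2) := sqrt_pos.2 hpos
  set σ := √(u 0 ^ 2 + u 1 ^ 2) with hσdef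
  have hunit : (u 0 / σ) ^ 2 + (u 1 / σ) ^ 2 = 1 := by
    rw [div_pow, div_pow, ← add_div, hσdef, sq_sqrt hpos.le, div_self hpos.ne']
  conv_rhs => rw [← pi_gaussianReal_map_linear_combination hunit]
  rw [map_measureReal_apply (by fun_prop) measurableSet_Icc]
  congr 1
  ext g
  rw [Set.mem_preimage, Set.mem_Icc, ← abs_le, strip, Set.mem_ofPred_eq, ← hσdef,
    show u 0 / σ * g 0 + u 1 / σ * g 1 = (u 0 * g 0 + u 1 * g 1) / σ by ring, abs_div,
    abs_of_pos hσ, div_le_iff₀ hσ]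

lemma mem_strip_of_heaviside_ne {ε : ℝ} {u g e : Fin 2 → ℝ} (he : ∀ i, |e i| ≤ ε)
    (h : (if 0 ≤ ∑ i, (g i + e i) * u i then (1 : ℝ) else 0) ≠
      if 0 ≤ ∑ i, g i * u i then 1 else 0) : g ∈ strip (√2 * ε) u := by
  have h' := abs_le_abs_sub_of_heaviside_ne h
  simp only [Fin.sum_univ_two] at h'
  calc |u 0 * g 0 + u 1 * g 1| = |g 0 * u 0 + g 1 * u 1| := by ring_nf
    _ ≤ |u 0 * e 0 + u 1 * e 1| := h'.trans_eq (by ring_nf)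
    _ ≤ _ := abs_linear_combination_le (he 0) (he 1)

lemma pi_gaussianReal_real_strip_union_le {ε : ℝ} {u v : Fin 2 → ℝ}
    (hu : u ≠ 0) (hv : v ≠ 0) :
    (Measure.pi fun _ : Fin 2 ↦ gaussianReal 0 1).real
        (strip (√2 * ε) u ∪ strip (√2 * ε) v) ≤
      2 * (gaussianReal 0 1).real (Set.Icc (-(√2 * ε)) (√2 * ε)) -
        (gaussianReal 0 1).real (Set.Icc (-ε) ε) ^ 2 := by
  set μ := Measure.pi fun _ : Fin 2 ↦ gaussianReal 0 1 with hμ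
  have hsquare : μ.real (Set.univ.pi fun _ ↦ Set.Icc (-ε) ε) =
      (gaussianReal 0 1).real (Set.Icc (-ε) ε) ^ 2 := by
    rw [hμ, measureReal_def, Measure.pi_pi]
    simp [measureReal_def]
  have hsub : (Set.univ.pi fun _ ↦ Set.Icc (-ε) ε) ⊆
      strip (√2 * ε) u ∩ strip (√2 * ε) v := by
    intro g hg
    have hg' (i : Fin 2) : |g i| ≤ ε := abs_le.2 (hg i trivial)
    exact ⟨abs_linear_combination_le (hg' 0) (hg' 1), abs_linear_combination_le (hg' 0) (hg' 1)⟩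
  have hinter : μ.real (Set.univ.pi fun _ ↦ Set.Icc (-ε) ε) ≤
      μ.real (strip (√2 * ε) u ∩ strip (√2 * ε) v) := measureReal_mono hsub
  have hsum := measureReal_union_add_inter (μ := μ) (s := strip (√2 * ε) u)
    (measurableSet_strip (√2 * ε) v)
  rw [pi_gaussianReal_real_strip _ hu, pi_gaussianReal_real_strip _ hv] at hsum
  linarith

lemma three_mul_sq_le {m t : ℝ} (hm : 0 < m) (ht : 0 ≤ t) :
    3 * t ^ 2 ≤ 2 * m * t ^ 3 + 1 / m ^ 2 := by
  have h : 2 * m * t ^ 3 + 1 / m ^ 2 - 3 * t ^ 2 = (m * t - 1) ^ 2 * (2 * (m * t) + 1) / m ^ 2 := by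
    field_simp
    ring
  have : 0 ≤ (m * t - 1) ^ 2 * (2 * (m * t) + 1) / m ^ 2 := by positivity
  linarith

lemma sqrt_two_mul_pi_lt : √(2 * π) < 2.51 := by
  rw [sqrt_lt' (by norm_num)]
  linarith [pi_lt_d2]

lemma strip_polynomial_le {t : ℝ} (ht : 0 ≤ t) (ht' : t ≤ 0.725) :
    5.02 * t ^ 3 * (1 - 2 / 3 * t ^ 6 + 2 / 5 * t ^ 12) - 2 * t ^ 6 * (1 - t ^ 6 / 3) ^ 2 ≤
      3 * t ^ 2 := by
  have hw : t ^ 6 ≤ 0.15 := (pow_le_pow_left₀ ht ht' 6).trans (by norm_num)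
  have hw0 : 0 ≤ t ^ 6 := by positivity
  have h1 : 1 - 2 / 3 * t ^ 6 + 2 / 5 * t ^ 12 ≤ 1 - 0.6 * t ^ 6 := by nlinarith
  have h2 : 0.9 ≤ (1 - t ^ 6 / 3) ^ 2 := by nlinarith
  have h4 : 4 * 0.7 ^ 3 * t - 3 * 0.7 ^ 4 ≤ t ^ 4 := by
    nlinarith [sq_nonneg (t ^ 2 - 0.7 ^ 2), sq_nonneg (t - 0.7)]
  have h7 : 7 * 0.7 ^ 6 * t - 6 * 0.7 ^ 7 ≤ t ^ 7 := by
    have : 0 ≤ (t - 0.7) ^ 2 * (t ^ 5 + 2 * 0.7 * t ^ 4 + 3 * 0.7 ^ 2 * t ^ 3 +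
      4 * 0.7 ^ 3 * t ^ 2 + 5 * 0.7 ^ 4 * t + 6 * 0.7 ^ 5) := by positivity
    linarith
  have key : 5.02 * t - 3.012 * t ^ 7 - 1.8 * t ^ 4 ≤ 3 := by norm_num at h4 h7 ⊢; linarith
  calc _ ≤ 5.02 * t ^ 3 * (1 - 0.6 * t ^ 6) - 2 * t ^ 6 * 0.9 := by gcongr
    _ = t ^ 2 * (5.02 * t - 3.012 * t ^ 7 - 1.8 * t ^ 4) := by ring
    _ ≤ t ^ 2 * 3 := by gcongr
    _ = 3 * t ^ 2 := by ring

lemma two_strips_bound_le {t : ℝ} (ht : 0 ≤ t) (ht' : t ≤ 0.725) :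
    2 * (gaussianReal 0 1).real (Set.Icc (-(2 * t ^ 3)) (2 * t ^ 3)) -
        (gaussianReal 0 1).real (Set.Icc (-(√2 * t ^ 3)) (√2 * t ^ 3)) ^ 2 ≤
      2 / π * (3 * t ^ 2) := by
  have hw : t ^ 6 ≤ 0.15 := (pow_le_pow_left₀ ht ht' 6).trans (by norm_num)
  have h2 : √2 ^ 2 = 2 := sq_sqrt zero_le_two
  have hup := gaussianReal_real_Icc_neg_le (s := 2 * t ^ 3) (by positivity)
  have hlow := le_gaussianReal_real_Icc_neg (s := √2 * t ^ 3) (by positivity)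
  have hk : (√(2 * π))⁻¹ ≤ 2.51 / (2 * π) := by
    rw [← sqrt_div_self, div_eq_mul_inv, div_eq_mul_inv]
    gcongr
    exact sqrt_two_mul_pi_lt.le
  have hk2 : (√(2 * π))⁻¹ ^ 2 = 1 / (2 * π) := by
    rw [inv_pow, sq_sqrt (by positivity), one_div]
  set k := (√(2 * π))⁻¹
  have hk0 : 0 ≤ k := by positivity
  have hlow' : 4 / π * (t ^ 6 * (1 - t ^ 6 / 3) ^ 2) ≤
      (gaussianReal 0 1).real (Set.Icc (-(√2 * t ^ 3)) (√2 * t ^ 3)) ^ 2 := by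
    have heq : k * (2 * (√2 * t ^ 3 - (√2 * t ^ 3) ^ 3 / 6)) =
        k * √2 * (2 * t ^ 3 * (1 - t ^ 6 / 3)) := by
      linear_combination (-k * √2 * t ^ 9 / 3) * h2
    rw [heq] at hlow
    have hnn : 0 ≤ k * √2 * (2 * t ^ 3 * (1 - t ^ 6 / 3)) := by
      have : 0 ≤ 1 - t ^ 6 / 3 := by linarith
      positivity
    refine le_trans (le_of_eq ?_) (pow_le_pow_left₀ hnn hlow 2)
    rw [mul_pow, mul_pow, hk2, h2]
    field_simp
    ring
  have hup' : 2 * (k * (2 * (2 * t ^ 3 - (2 * t ^ 3) ^ 3 / 6 + (2 * t ^ 3) ^ 5 / 40))) ≤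
      2 / π * (5.02 * t ^ 3 * (1 - 2 / 3 * t ^ 6 + 2 / 5 * t ^ 12)) := by
    have : 0 ≤ 1 - 2 / 3 * t ^ 6 + 2 / 5 * t ^ 12 := by nlinarith [sq_nonneg (t ^ 6)]
    calc _ = k * (8 * t ^ 3 * (1 - 2 / 3 * t ^ 6 + 2 / 5 * t ^ 12)) := by ring
      _ ≤ 2.51 / (2 * π) * (8 * t ^ 3 * (1 - 2 / 3 * t ^ 6 + 2 / 5 * t ^ 12)) := by gcongr
      _ = _ := by field_simp; ring
  have hpoly := mul_le_mul_of_nonneg_left (strip_polynomial_le ht ht')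
    (show 0 ≤ 2 / π by positivity)
  have hsplit : 2 / π * (5.02 * t ^ 3 * (1 - 2 / 3 * t ^ 6 + 2 / 5 * t ^ 12) -
      2 * t ^ 6 * (1 - t ^ 6 / 3) ^ 2) =
      2 / π * (5.02 * t ^ 3 * (1 - 2 / 3 * t ^ 6 + 2 / 5 * t ^ 12)) -
      4 / π * (t ^ 6 * (1 - t ^ 6 / 3) ^ 2) := by ring
  linarith

/-- for a standard Gaussian vector `g` in `ℝ²`, nonzero `u¹, u² ∈ ℝ²`,
`ε > 0` and `m ≥ 1`, the probability that some perturbation `e` with `‖e‖_∞ ≤ ε` flips one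
of the Heaviside indicators `1_{⟨g,uʲ⟩ ≥ 0}` is at most `2√2·m·ε/π + 2/(π·m²)`. -/
theorem heaviside_perturbation_bound (ε : ℝ) (hε : 0 < ε) (m : ℝ) (hm : 1 ≤ m)
    (u1 u2 : Fin 2 → ℝ) (h1 : u1 ≠ 0) (h2 : u2 ≠ 0) :
    (Measure.pi fun _ : Fin 2 => gaussianReal 0 1)
      {g : Fin 2 → ℝ | ∃ e : Fin 2 → ℝ, (∀ i, |e i| ≤ ε) ∧
        (((if 0 ≤ ∑ i, (g i + e i) * u1 i then (1 : ℝ) else 0) ≠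
            (if 0 ≤ ∑ i, g i * u1 i then (1 : ℝ) else 0)) ∨
         ((if 0 ≤ ∑ i, (g i + e i) * u2 i then (1 : ℝ) else 0) ≠
            (if 0 ≤ ∑ i, g i * u2 i then (1 : ℝ) else 0)))} ≤
      ENNReal.ofReal (2 * Real.sqrt 2 * m * ε / π + 2 / (π * m ^ 2)) := by
  set μ := Measure.pi fun _ : Fin 2 ↦ gaussianReal 0 1
  obtain ⟨t, ht, rfl⟩ : ∃ t : ℝ, 0 ≤ t ∧ √2 * t ^ 3 = ε := by
    refine ⟨(ε / √2) ^ (3⁻¹ : ℝ), by positivity, ?_⟩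
    rw [← rpow_natCast, ← rpow_mul (by positivity)]
    norm_num
    field_simp
  have hwidth : √2 * (√2 * t ^ 3) = 2 * t ^ 3 := by
    rw [← mul_assoc, mul_self_sqrt zero_le_two]
  have hunion : μ.real (strip (√2 * (√2 * t ^ 3)) u1 ∪ strip (√2 * (√2 * t ^ 3)) u2) ≤
      2 / π * (3 * t ^ 2) := by
    rcases le_total t 0.725 with htle | htle
    · refine (pi_gaussianReal_real_strip_union_le h1 h2).trans ?_
      rw [hwidth]
      exact two_strips_bound_le ht htle
    · refine measureReal_le_one.trans ?_
      rw [div_mul_eq_mul_div, le_div_iff₀ pi_pos]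
      nlinarith [pi_lt_d2]
  calc _ ≤ μ (strip (√2 * (√2 * t ^ 3)) u1 ∪ strip (√2 * (√2 * t ^ 3)) u2) := by
        refine measure_mono ?_
        rintro g ⟨e, he, h | h⟩
        · exact Or.inl (mem_strip_of_heaviside_ne he h)
        · exact Or.inr (mem_strip_of_heaviside_ne he h)
    _ = ENNReal.ofReal (μ.real _) := (ofReal_measureReal).symm
    _ ≤ _ := by
        refine ENNReal.ofReal_le_ofReal (hunion.trans ?_)
        calc 2 / π * (3 * t ^ 2) ≤ 2 / π * (2 * m * t ^ 3 + 1 / m ^ 2) := by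
              gcongr
              exact three_mul_sq_le (by linarith) ht
          _ = 2 * m * (2 * t ^ 3) / π + 2 / (π * m ^ 2) := by field_simp
          _ = _ := by rw [← hwidth]; ring
end

section
/- Let u ≥ 1 be an integer and let g be a standard Gaussian vector in ℝ^u. Then P[‖g‖₂ > u] ≤ √(2u/π)·e^{−u/2}. -/
open MeasureTheory ProbabilityTheory Real

lemma integrableOn_mul_exp_neg_sq_div_two {t : ℝ} (ht : 0 < t) :
    IntegrableOn (fun x : ℝ => x * exp (-x ^ 2 / 2)) (Set.Ioi t) ∧
      ∫ x in Set.Ioi t, x * exp (-x ^ 2 / 2) = exp (-t ^ 2 / 2) := by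
  have hd : ∀ x ∈ Set.Ici t,
      HasDerivAt (fun x : ℝ => -exp (-x ^ 2 / 2)) (x * exp (-x ^ 2 / 2)) x := by
    intro x _
    have h := ((((hasDerivAt_id x).pow 2).neg.div_const 2).exp).neg
    refine h.congr_deriv ?_
    simp
    ring
  have hlim : Filter.Tendsto (fun x : ℝ => -exp (-x ^ 2 / 2)) Filter.atTop (nhds 0) := by
    rw [← neg_zero]
    refine (Real.tendsto_exp_atBot.comp ?_).neg
    refine Filter.Tendsto.atBot_div_const (by norm_num) ?_
    exact Filter.tendsto_neg_atTop_atBot.comp (Filter.tendsto_pow_atTop (by norm_num))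
  have hnn : ∀ x ∈ Set.Ioi t, 0 ≤ x * exp (-x ^ 2 / 2) := fun x hx =>
    mul_nonneg (ht.trans hx).le (exp_pos _).le
  refine ⟨integrableOn_Ioi_deriv_of_nonneg' hd hnn hlim, ?_⟩
  rw [integral_Ioi_of_hasDerivAt_of_nonneg' hd hnn hlim]
  simp

/-- The Mills ratio upper bound for the upper tail of a standard Gaussian. -/
lemma gaussianReal_Ioi_le {t : ℝ} (ht : 0 < t) :
    gaussianReal 0 1 (Set.Ioi t) ≤
      ENNReal.ofReal ((t * √(2 * π))⁻¹ * exp (-t ^ 2 / 2)) := by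
  obtain ⟨hint, hval⟩ := integrableOn_mul_exp_neg_sq_div_two ht
  rw [gaussianReal_apply _ one_ne_zero, ← hval, ← integral_const_mul,
    ofReal_integral_eq_lintegral_ofReal (hint.const_mul _)]
  · refine setLIntegral_mono' measurableSet_Ioi fun x hx => ?_
    refine ENNReal.ofReal_le_ofReal ?_
    have hx' : t ≤ x := le_of_lt hx
    have h1 : 1 ≤ t⁻¹ * x := by rw [inv_mul_eq_div]; exact (one_le_div ht).2 hx'
    have h2 : 0 ≤ (√(2 * π))⁻¹ * exp (-x ^ 2 / 2) := by positivity
    calc gaussianPDFReal 0 1 x = 1 * ((√(2 * π))⁻¹ * exp (-x ^ 2 / 2)) := by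
          simp [gaussianPDFReal]
      _ ≤ t⁻¹ * x * ((√(2 * π))⁻¹ * exp (-x ^ 2 / 2)) := by gcongr
      _ = _ := by rw [mul_inv]; ring
  · filter_upwards [ae_restrict_mem measurableSet_Ioi] with x hx
    have : 0 < x := ht.trans hx
    simp only [Pi.zero_apply]
    positivity

lemma gaussianReal_lt_abs_le {t : ℝ} (ht : 0 < t) :
    gaussianReal 0 1 {x | t < |x|} ≤
      ENNReal.ofReal (2 * ((t * √(2 * π))⁻¹ * exp (-t ^ 2 / 2))) := by
  have hsymm : gaussianReal 0 1 (Neg.neg ⁻¹' Set.Ioi t) = gaussianReal 0 1 (Set.Ioi t) := by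
    rw [← Measure.map_apply measurable_neg measurableSet_Ioi]
    congr 1
    simpa using gaussianReal_map_neg (μ := 0) (v := 1)
  have hset : {x : ℝ | t < |x|} = Set.Ioi t ∪ Neg.neg ⁻¹' Set.Ioi t := by
    ext x
    simp [lt_abs, lt_neg]
  rw [hset, ENNReal.ofReal_mul zero_le_two, ENNReal.ofReal_ofNat, two_mul]
  refine (measure_union_le _ _).trans ?_
  rw [hsymm]
  exact add_le_add (gaussianReal_Ioi_le ht) (gaussianReal_Ioi_le ht)

/-- if `g` is a standard Gaussian vector in `ℝ^u` (`u ≥ 1`), then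
`P[‖g‖₂ > u] ≤ √(2u/π) · e^{−u/2}`. -/
theorem gaussian_norm_tail_bound (u : ℕ) (hu : 1 ≤ u) :
    (Measure.pi fun _ : Fin u => gaussianReal 0 1)
      {g : Fin u → ℝ | (u : ℝ) < Real.sqrt (∑ i, (g i) ^ 2)} ≤
      ENNReal.ofReal (Real.sqrt (2 * u / π) * Real.exp (-(u : ℝ) / 2)) := by
  have hu0 : (0 : ℝ) < u := by exact_mod_cast hu
  have hsub : {g : Fin u → ℝ | (u : ℝ) < √(∑ i, (g i) ^ 2)} ⊆
      ⋃ i, Function.eval i ⁻¹' {x : ℝ | √u < |x|} := by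
    intro g hg
    by_contra hcon
    simp only [Set.mem_iUnion, Set.mem_preimage, Set.mem_ofPred_eq, Function.eval, not_exists,
      not_lt] at hcon
    have hsum : ∑ i, (g i) ^ 2 ≤ (u : ℝ) ^ 2 :=
      calc ∑ i, (g i) ^ 2 ≤ ∑ _i : Fin u, (u : ℝ) := Finset.sum_le_sum fun i _ => by
            rw [← sq_abs, ← Real.sq_sqrt hu0.le]
            exact pow_le_pow_left₀ (abs_nonneg _) (hcon i) 2
        _ = (u : ℝ) ^ 2 := by simp [sq]
    exact absurd hg (not_lt.2 (Real.sqrt_le_iff.2 ⟨hu0.le, hsum⟩))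
  have hmeas : MeasurableSet {x : ℝ | √u < |x|} :=
    measurableSet_lt measurable_const measurable_id.abs
  refine (measure_mono hsub).trans ((measure_iUnion_fintype_le _ _).trans ?_)
  simp_rw [(measurePreserving_eval (fun _ : Fin u => gaussianReal 0 1) _).measure_preimage
    hmeas.nullMeasurableSet]
  refine (Finset.sum_le_sum fun i _ => gaussianReal_lt_abs_le (Real.sqrt_pos.2 hu0)).trans_eq ?_
  rw [Finset.sum_const, Finset.card_univ, Fintype.card_fin, ← ENNReal.ofReal_nsmul,
    Real.sq_sqrt hu0.le, nsmul_eq_mul]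
  congr 1
  rw [Real.sqrt_div (by positivity), Real.sqrt_mul zero_le_two, Real.sqrt_mul zero_le_two]
  have h2 : √2 ^ 2 = (2 : ℝ) := Real.sq_sqrt zero_le_two
  have h3 : √(u : ℝ) ^ 2 = u := Real.sq_sqrt hu0.le
  have : 0 < √(u : ℝ) := Real.sqrt_pos.2 hu0
  have : 0 < √π := Real.sqrt_pos.2 pi_pos
  field_simp
  rw [h2, h3]
end
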